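/- arXiv:1303.4117 — 3 statements merged into one kernel-verified Lean document; each statement's English description precedes it below -/
import Mathlib

section
/- Let S be a set of points of PG(2,q) and let R = ℒᵒ(S). Then |R| is even; moreover, if |S| is odd then S = 𝒫ᵉ(R), and if |S| is even then S = 𝒫ᵒ(R). Dually, if R is a set of lines and S = 𝒫ᵒ(R), then |S| is even; moreover, if |R| is odd then R = ℒᵉ(S), and if |R| is even then R = ℒᵒ(S). -/
open scoped BigOperators

/-- Points (and, by self-duality of homogeneous coordinates, lines) of the
Desarguesian projective plane `PG(2,q)` over the field `F`. -/
abbrev PG (F : Type*) [Field F] := Projectivization F (Fin 3 → F)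

/-- Incidence between a point and a line (the line being given by its dual
homogeneous coordinates): the dot product of representatives vanishes.
This does not depend on the choice of representatives. -/
def Incid {F : Type*} [Field F] (p l : PG F) : Prop :=
  ∑ i, p.rep i * l.rep i = 0

/-- `𝒫ᵒ(R)`: points incident with an odd number of lines of `R`. -/
def Podd (F : Type*) [Field F] (R : Set (PG F)) : Set (PG F) :=
  {p | Odd {l ∈ R | Incid p l}.ncard}

/-- `𝒫ᵉ(R)`: points incident with an even number of lines of `R`. -/
def Peven (F : Type*) [Field F] (R : Set (PG F)) : Set (PG F) :=
  {p | Even {l ∈ R | Incid p l}.ncard}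

/-- `ℒᵒ(S)`: lines meeting `S` in an odd number of points. -/
def Lodd (F : Type*) [Field F] (S : Set (PG F)) : Set (PG F) :=
  {l | Odd {p ∈ S | Incid p l}.ncard}

/-- `ℒᵉ(S)`: lines meeting `S` in an even number of points. -/
def Leven (F : Type*) [Field F] (S : Set (PG F)) : Set (PG F) :=
  {l | Even {p ∈ S | Incid p l}.ncard}

/-- `f(r)`: the minimum size of the symmetric difference of `r` distinct lines,
i.e. the minimum of `|𝒫ᵒ(R)|` over sets `R` of exactly `r` lines. -/
noncomputable def fmin (F : Type*) [Field F] (r : ℕ) : ℕ :=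
  sInf {n | ∃ R : Set (PG F), R.ncard = r ∧ (Podd F R).ncard = n}

lemma incid_iff_orthogonal {F : Type*} [Field F] (p l : PG F) :
    Incid p l ↔ Projectivization.orthogonal p l := by
  unfold Incid
  conv_rhs => rw [← p.mk_rep, ← l.mk_rep]
  rw [Projectivization.orthogonal_mk p.rep_nonzero l.rep_nonzero]
  rfl

lemma incid_comm' {F : Type*} [Field F] (p l : PG F) : Incid p l ↔ Incid l p := by
  unfold Incid
  simp only [mul_comm]

open Configuration in
lemma lines_through {F : Type*} [Field F] [Fintype F] (hq : Odd (Fintype.card F)) (p : PG F) :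
    Even {l : PG F | Incid p l}.ncard := by
  classical
  have h1 := ProjectivePlane.lineCount_eq (PG F) (P := PG F) p
  have h2 : {l : PG F | Incid p l}.ncard = lineCount (PG F) p := by
    rw [lineCount, ← Nat.card_coe_set_eq]
    apply Nat.card_congr
    exact Equiv.subtypeEquivRight fun l => incid_iff_orthogonal p l
  have h3 : ProjectivePlane.order (PG F) (PG F) = Fintype.card F := by
    have := Fintype.ofFinite (PG F)
    have h4 := ProjectivePlane.card_points (PG F) (PG F)
    have h5 := Projectivization.card_of_finrank F (Fin 3 → F) (n := 3) (by simp)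
    rw [Nat.card_eq_fintype_card, h4] at h5
    simp only [Finset.sum_range_succ, Finset.range_zero, Finset.sum_empty,
      Nat.card_eq_fintype_card] at h5
    rcases lt_trichotomy (ProjectivePlane.order (PG F) (PG F)) (Fintype.card F) with h | h | h
    · nlinarith
    · exact h
    · nlinarith
  rw [h2, h1, h3]
  exact hq.add_one

open Configuration in
lemma lines_two {F : Type*} [Field F] [Fintype F] {p p' : PG F} (h : p ≠ p') :
    {l : PG F | Incid p l ∧ Incid p' l}.ncard = 1 := by
  classical
  rw [Set.ncard_eq_one]
  have hm := HasLines.mkLine_ax (P := PG F) (L := PG F) h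
  refine ⟨HasLines.mkLine h, ?_⟩
  ext l
  simp only [Set.mem_ofPred_eq, Set.mem_singleton_iff, incid_iff_orthogonal]
  constructor
  · rintro ⟨h1, h2⟩
    exact (Configuration.ofField.eq_or_eq_of_orthogonal h1 h2 hm.1 hm.2).resolve_left h
  · rintro rfl
    exact hm

lemma main_aux {F : Type*} [Field F] [Fintype F] (hq : Odd (Fintype.card F)) (S : Set (PG F)) :
    Even (Lodd F S).ncard ∧ ∀ p, (Odd {l ∈ Lodd F S | Incid p l}.ncard ↔
      (Odd S.ncard ↔ p ∉ S)) := by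
  classical
  have := Fintype.ofFinite (PG F)
  have key : ∀ T : Set (PG F), ((T.ncard : ℕ) : ZMod 2) = ∑ x, if x ∈ T then 1 else 0 := by
    intro T
    rw [Set.ncard_eq_toFinset_card', Finset.sum_boole]
    congr 2
    ext; simp
  have hodd : ∀ n : ℕ, (if Odd n then (1 : ZMod 2) else 0) = n := by
    intro n
    split_ifs with h
    · exact (ZMod.natCast_eq_one_iff_odd.mpr h).symm
    · exact ((ZMod.natCast_eq_zero_iff_even).mpr (Nat.not_odd_iff_even.mp h)).symm
  have hL : ∀ l, (if l ∈ Lodd F S then (1 : ZMod 2) else 0)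
      = ∑ x, (if x ∈ S then 1 else 0) * (if Incid x l then 1 else 0) := by
    intro l
    have := hodd {p ∈ S | Incid p l}.ncard
    rw [key] at this
    have h0 : (if l ∈ Lodd F S then (1 : ZMod 2) else 0)
        = if Odd {p ∈ S | Incid p l}.ncard then 1 else 0 := if_congr Iff.rfl rfl rfl
    refine (h0.trans this).trans (Finset.sum_congr rfl fun x _ => ?_)
    by_cases h1 : x ∈ S <;> by_cases h2 : Incid x l <;> simp [h1, h2]
  have hI : ∀ x : PG F, (∑ l : PG F, if Incid x l then (1 : ZMod 2) else 0) = 0 := by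
    intro x
    have := key {l | Incid x l}
    rw [ZMod.natCast_eq_zero_iff_even.mpr (lines_through hq x)] at this
    exact this.symm
  have hII : ∀ p x : PG F, (∑ l : PG F, (if Incid x l then (1 : ZMod 2) else 0) *
      (if Incid p l then 1 else 0)) = if x = p then 0 else 1 := by
    intro p x
    split_ifs with h
    · subst h
      refine Eq.trans ?_ (hI x)
      refine Finset.sum_congr rfl fun l _ => ?_
      split_ifs <;> simp
    · have := key {l | Incid x l ∧ Incid p l}
      rw [lines_two h] at this
      rw [Nat.cast_one] at this
      refine Eq.trans ?_ this.symm
      refine Finset.sum_congr rfl fun l _ => ?_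
      by_cases h1 : Incid x l <;> by_cases h2 : Incid p l <;> simp [h1, h2]
  constructor
  · rw [← ZMod.natCast_eq_zero_iff_even, key]
    simp_rw [hL]
    rw [Finset.sum_comm]
    simp_rw [← Finset.mul_sum, hI]
    simp
  · intro p
    have e : (({l ∈ Lodd F S | Incid p l}.ncard : ℕ) : ZMod 2)
        = S.ncard - if p ∈ S then 1 else 0 := by
      rw [key, key S]
      have : ∀ l, (if l ∈ {l | l ∈ Lodd F S ∧ Incid p l} then (1 : ZMod 2) else 0)
          = ∑ x, (if x ∈ S then 1 else 0) * ((if Incid x l then 1 else 0) *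
            (if Incid p l then 1 else 0)) := by
        intro l
        simp_rw [← mul_assoc]
        rw [← Finset.sum_mul, ← hL]
        by_cases h1 : l ∈ Lodd F S <;> by_cases h2 : Incid p l <;> simp [h1, h2]
      refine (Finset.sum_congr rfl fun l _ => (by convert this l)).trans ?_
      rw [Finset.sum_comm]
      simp_rw [← Finset.mul_sum, hII]
      rw [eq_sub_iff_add_eq]
      have h3 : (if p ∈ S then (1 : ZMod 2) else 0)
          = ∑ x, (if x ∈ S then 1 else 0) * (if x = p then 1 else 0) := by
        simp
      rw [h3, ← Finset.sum_add_distrib]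
      refine Finset.sum_congr rfl fun x _ => ?_
      by_cases h1 : x ∈ S <;> by_cases h2 : x = p <;> simp [h1, h2]
    rw [← ZMod.natCast_eq_one_iff_odd, ← ZMod.natCast_eq_one_iff_odd, e]
    generalize ((S.ncard : ℕ) : ZMod 2) = a
    by_cases h : p ∈ S <;> simp only [h, if_true, if_false, not_true, not_false_eq_true, iff_true, iff_false, sub_zero]
    revert a; decide

lemma Podd_eq {F : Type*} [Field F] (R : Set (PG F)) : Podd F R = Lodd F R := by
  unfold Podd Lodd
  simp_rw [incid_comm']

lemma Peven_eq {F : Type*} [Field F] (R : Set (PG F)) : Peven F R = Leven F R := by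
  unfold Peven Leven
  simp_rw [incid_comm']

lemma main_aux2 {F : Type*} [Field F] [Fintype F] (hq : Odd (Fintype.card F)) (S : Set (PG F)) :
    Even (Lodd F S).ncard ∧ (Odd S.ncard → S = Peven F (Lodd F S)) ∧
      (Even S.ncard → S = Podd F (Lodd F S)) := by
  obtain ⟨h1, h2⟩ := main_aux hq S
  refine ⟨h1, fun h => ?_, fun h => ?_⟩
  · ext p
    have := h2 p
    simp only [Peven, Set.mem_ofPred_eq, ← Nat.not_odd_iff_even]
    tauto
  · ext p
    have := h2 p
    rw [← Nat.not_odd_iff_even] at h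
    simp only [Podd, Set.mem_ofPred_eq]
    tauto

/-- If `R = ℒᵒ(S)` then `|R|` is even; moreover `S = 𝒫ᵉ(R)` if `|S|` is odd and
`S = 𝒫ᵒ(R)` if `|S|` is even.  Dually, if `S = 𝒫ᵒ(R)` then `|S|` is even;
moreover `R = ℒᵉ(S)` if `|R|` is odd and `R = ℒᵒ(S)` if `|R|` is even. -/
theorem stmt0 {F : Type*} [Field F] [Fintype F] (q : ℕ)
    (hcard : Fintype.card F = q) (hq : Odd q) :
    (∀ S R : Set (PG F), R = Lodd F S →
      Even R.ncard ∧ (Odd S.ncard → S = Peven F R) ∧ (Even S.ncard → S = Podd F R)) ∧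
    (∀ R S : Set (PG F), S = Podd F R →
      Even S.ncard ∧ (Odd R.ncard → R = Leven F S) ∧ (Even R.ncard → R = Lodd F S)) := by
  subst hcard
  refine ⟨?_, ?_⟩
  · rintro S R rfl
    exact main_aux2 hq S
  · rintro R S rfl
    have := main_aux2 hq R
    rw [Podd_eq, ← Peven_eq, ← Podd_eq (Lodd F R)]
    exact this
end

section
/- For every integer r with 0 < r < N − 2, |f(r + 1) − f(r)| ≤ q − 1. -/
open scoped BigOperators

lemma incid_iff {F : Type*} [Field F] (p l : PG F) : Incid p l ↔ p.orthogonal l := by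
  have h := Projectivization.orthogonal_mk (F := F) p.rep_nonzero l.rep_nonzero
  rw [Projectivization.mk_rep, Projectivization.mk_rep] at h
  rw [h]
  rfl

lemma card_PG {F : Type*} [Field F] [Fintype F] :
    Nat.card (PG F) = Fintype.card F ^ 2 + Fintype.card F + 1 := by
  rw [Projectivization.card_of_finrank F (Fin 3 → F) (n := 3) (by simp)]
  simp [Finset.sum_range_succ]
  ring

lemma order_PG {F : Type*} [Field F] [Fintype F] [DecidableEq F] :
    Configuration.ProjectivePlane.order (PG F) (PG F) = Fintype.card F := by
  have : Fintype (PG F) := Fintype.ofFinite _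
  have h := Configuration.ProjectivePlane.card_points (PG F) (PG F)
  rw [← Nat.card_eq_fintype_card, card_PG] at h
  nlinarith [lt_trichotomy (Fintype.card F) (Configuration.ProjectivePlane.order (PG F) (PG F))]

lemma ncard_lines {F : Type*} [Field F] [Fintype F] (p : PG F) :
    {l : PG F | Incid p l}.ncard = Fintype.card F + 1 := by
  classical
  have h := Configuration.ProjectivePlane.lineCount_eq (PG F) p
  rw [order_PG] at h
  rw [← h, Configuration.lineCount, ← Nat.card_coe_set_eq]
  simp only [incid_iff]
  rfl

lemma ncard_points {F : Type*} [Field F] [Fintype F] (l : PG F) :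
    {p : PG F | Incid p l}.ncard = Fintype.card F + 1 := by
  rw [← ncard_lines l]
  simp only [incid_iff]
  simp only [Projectivization.orthogonal_comm (w := l)]

lemma ncard_inter {F : Type*} [Field F] {l m : PG F} (h : l ≠ m) :
    {p : PG F | Incid p l ∧ Incid p m}.ncard = 1 := by
  classical
  obtain ⟨p, hp, hu⟩ := Configuration.HasPoints.existsUnique_point (PG F) (PG F) l m h
  rw [Set.ncard_eq_one]
  refine ⟨p, ?_⟩
  ext x
  simp only [incid_iff, Set.mem_setOf_eq, Set.mem_singleton_iff]
  constructor
  · exact hu x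
  · rintro rfl
    exact hp

lemma podd_insert {F : Type*} [Field F] [Fintype F] (R : Set (PG F)) (l : PG F) (hl : l ∉ R) :
    Podd F (insert l R) = symmDiff (Podd F R) {p | Incid p l} := by
  ext p
  rw [Set.mem_symmDiff]
  simp only [Podd, Set.mem_setOf_eq]
  by_cases hp : Incid p l
  · have : {m | m ∈ insert l R ∧ Incid p m} = insert l {m | m ∈ R ∧ Incid p m} := by
      ext m
      simp only [Set.mem_setOf_eq, Set.mem_insert_iff]
      grind
    rw [this, Set.ncard_insert_of_notMem (by simp [hl]) (Set.toFinite _)]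
    grind
  · have : {m | m ∈ insert l R ∧ Incid p m} = {m | m ∈ R ∧ Incid p m} := by
      ext m
      simp only [Set.mem_setOf_eq, Set.mem_insert_iff]
      grind
    rw [this]
    grind

lemma ncard_symmDiff_le {α : Type*} [Finite α] (A B : Set α) (p : α) (hA : p ∈ A) (hB : p ∈ B) :
    (symmDiff A B).ncard + 2 ≤ A.ncard + B.ncard := by
  have h1 := Set.ncard_diff_singleton_add_one hA (Set.toFinite _)
  have h2 := Set.ncard_diff_singleton_add_one hB (Set.toFinite _)
  have h3 : symmDiff A B ⊆ (A \ {p}) ∪ (B \ {p}) := by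
    intro x hx
    rw [Set.mem_symmDiff] at hx
    simp only [Set.mem_union, Set.mem_diff, Set.mem_singleton_iff]
    grind
  have h4 := Set.ncard_le_ncard h3 (Set.toFinite _)
  have h5 := Set.ncard_union_le (A \ {p}) (B \ {p})
  omega

lemma podd_count {F : Type*} [Field F] [Fintype F] (hq : Odd (Fintype.card F))
    (R : Set (PG F)) (h : Podd F R = ∅) (l : PG F) : Even (R \ {l}).ncard := by
  classical
  have : Fintype (PG F) := Fintype.ofFinite _
  have hev : ∀ p : PG F, Even {m | m ∈ R ∧ Incid p m}.ncard := by
    intro p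
    rw [← Nat.not_odd_iff_even]
    intro hp
    have : p ∈ Podd F R := hp
    simp [h] at this
  have hlin : ∀ p : PG F, Incid p l → ({m | m ∈ R \ {l} ∧ Incid p m}.ncard : ZMod 2)
      = if l ∈ R then 1 else 0 := by
    intro p hp
    have e := hev p
    split_ifs with hl
    · have h1 : {m | m ∈ R ∧ Incid p m} = insert l {m | m ∈ R \ {l} ∧ Incid p m} := by
        ext m
        simp only [Set.mem_setOf_eq, Set.mem_insert_iff, Set.mem_diff, Set.mem_singleton_iff]
        grind
      rw [h1, Set.ncard_insert_of_notMem (by simp) (Set.toFinite _)] at e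
      rw [ZMod.natCast_eq_one_iff_odd]
      grind
    · rw [Set.diff_singleton_eq_self hl]
      rwa [ZMod.natCast_eq_zero_iff_even]
  have hdc := Finset.sum_card_bipartiteAbove_eq_sum_card_bipartiteBelow
    (s := Finset.univ.filter (fun p : PG F => Incid p l))
    (t := Finset.univ.filter (fun m : PG F => m ∈ R \ {l})) (Incid (F := F))
  have hb : ∀ m ∈ Finset.univ.filter (fun m : PG F => m ∈ R \ {l}),
      ((Finset.univ.filter (fun p : PG F => Incid p l)).bipartiteBelow Incid m).card = 1 := by
    intro m hm
    simp only [Finset.mem_filter, Set.mem_diff, Set.mem_singleton_iff] at hm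
    rw [← ncard_inter (F := F) (l := l) (m := m) (by grind), ← Set.ncard_coe_finset]
    congr 1
    ext p
    simp [Finset.bipartiteBelow]
  rw [Finset.sum_congr rfl hb] at hdc
  have ha : ∀ p ∈ Finset.univ.filter (fun p : PG F => Incid p l),
      ((((Finset.univ.filter (fun m : PG F => m ∈ R \ {l})).bipartiteAbove Incid p).card : ℕ) :
        ZMod 2) = if l ∈ R then 1 else 0 := by
    intro p hp
    rw [← hlin p (by simpa using hp), ← Set.ncard_coe_finset]
    congr 2
    ext m
    simp [Finset.bipartiteAbove]
  have hc := congrArg (Nat.cast : ℕ → ZMod 2) hdc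
  rw [Nat.cast_sum, Finset.sum_congr rfl ha, Finset.sum_const, Finset.sum_const] at hc
  have hL : (Finset.univ.filter (fun p : PG F => Incid p l)).card = Fintype.card F + 1 := by
    rw [← ncard_points l, ← Set.ncard_coe_finset]
    congr 1
    ext p
    simp
  have hR : (Finset.univ.filter (fun m : PG F => m ∈ R \ {l})).card = (R \ {l}).ncard := by
    rw [← Set.ncard_coe_finset]
    congr 1
    ext p
    simp
  have hz : ((Fintype.card F + 1 : ℕ) : ZMod 2) = 0 := by
    rw [ZMod.natCast_eq_zero_iff_even]
    exact hq.add_one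
  rw [hL, hR, nsmul_eq_mul, hz, zero_mul] at hc
  rw [← ZMod.natCast_eq_zero_iff_even, hc]
  simp

lemma podd_nonempty {F : Type*} [Field F] [Fintype F] (hq : Odd (Fintype.card F))
    (R : Set (PG F)) (h0 : 0 < R.ncard) (h1 : R.ncard < Nat.card (PG F)) :
    (Podd F R).Nonempty := by
  rw [Set.nonempty_iff_ne_empty]
  intro h
  obtain ⟨l, hl⟩ := (Set.ncard_pos (Set.toFinite _)).1 h0
  have hne : R ≠ Set.univ := by
    rintro rfl
    rw [Set.ncard_univ] at h1
    omega
  obtain ⟨m, hm⟩ := (Set.ne_univ_iff_exists_notMem R).1 hne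
  have e1 := podd_count hq R h l
  have e2 := podd_count hq R h m
  rw [Set.diff_singleton_eq_self hm] at e2
  have := Set.ncard_diff_singleton_add_one hl (Set.toFinite _)
  grind

lemma fmin_attained {F : Type*} [Field F] [Fintype F] (r : ℕ) (h : r ≤ Nat.card (PG F)) :
    ∃ R : Set (PG F), R.ncard = r ∧ (Podd F R).ncard = fmin F r := by
  apply Nat.sInf_mem (s := {n | ∃ R : Set (PG F), R.ncard = r ∧ (Podd F R).ncard = n})
  rw [← Set.ncard_univ] at h
  obtain ⟨R, -, hR⟩ := Set.exists_subset_card_eq h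
  exact ⟨_, R, hR, rfl⟩

lemma fmin_le {F : Type*} [Field F] (R : Set (PG F)) : fmin F R.ncard ≤ (Podd F R).ncard :=
  Nat.sInf_le ⟨R, rfl, rfl⟩

/-- For `0 < r < N − 2`, `|f(r + 1) − f(r)| ≤ q − 1`. -/
theorem stmt5 {F : Type*} [Field F] [Fintype F] (q : ℕ)
    (hcard : Fintype.card F = q) (hq : Odd q)
    (r : ℕ) (hr0 : 0 < r) (hrN : r < q ^ 2 + q + 1 - 2) :
    |(fmin F (r + 1) : ℤ) - (fmin F r : ℤ)| ≤ (q : ℤ) - 1 := by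
  subst hcard
  have hN := card_PG (F := F)
  have h1 : fmin F (r + 1) + 2 ≤ fmin F r + (Fintype.card F + 1) := by
    obtain ⟨R, hR, hf⟩ := fmin_attained (F := F) r (by omega)
    obtain ⟨p, hp⟩ := podd_nonempty hq R (by omega) (by omega)
    have hex : ∃ l, l ∉ R ∧ Incid p l := by
      by_contra! hc
      have e : {l | l ∈ R ∧ Incid p l} = {l | Incid p l} := by
        ext l
        simp only [Set.mem_setOf_eq]
        grind
      have ho : Odd {l | l ∈ R ∧ Incid p l}.ncard := hp
      rw [e, ncard_lines] at ho
      grind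
    obtain ⟨l, hl, hpl⟩ := hex
    have hle := fmin_le (insert l R)
    rw [Set.ncard_insert_of_notMem hl (Set.toFinite _), hR, podd_insert R l hl] at hle
    have := ncard_symmDiff_le (Podd F R) {p | Incid p l} p hp hpl
    rw [ncard_points, hf] at this
    omega
  have h2 : fmin F r + 2 ≤ fmin F (r + 1) + (Fintype.card F + 1) := by
    obtain ⟨R, hR, hf⟩ := fmin_attained (F := F) (r + 1) (by omega)
    obtain ⟨p, hp⟩ := podd_nonempty hq R (by omega) (by omega)
    have ho : Odd {l | l ∈ R ∧ Incid p l}.ncard := hp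
    obtain ⟨l, hl, hpl⟩ := (Set.ncard_pos (Set.toFinite _)).1 ho.pos
    have hle := fmin_le (R \ {l})
    have hc := Set.ncard_diff_singleton_add_one hl (Set.toFinite _)
    have hc' : (R \ {l}).ncard = r := by omega
    rw [hc'] at hle
    have hi := podd_insert (R \ {l}) l (by simp)
    rw [Set.insert_diff_singleton, Set.insert_eq_of_mem hl] at hi
    have hi2 : Podd F (R \ {l}) = symmDiff (Podd F R) {p | Incid p l} := by
      rw [hi, symmDiff_symmDiff_cancel_right]
    have := ncard_symmDiff_le (Podd F R) {p | Incid p l} p hp hpl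
    rw [ncard_points, hf, ← hi2] at this
    omega
  rw [abs_le]
  constructor <;> omega
end

section
/- If q ≥ 7, then (3/2)(q + 1) ≤ f(q + 2) ≤ 2q − 2; moreover, if in addition q ≤ 13, then f(q + 2) = 2q − 2. -/
open scoped BigOperators

namespace Aux6

open scoped Classical in
/-- The finite type structure on the set of points (or lines). -/
noncomputable instance instFintypePG {F : Type*} [Field F] [Fintype F] : Fintype (PG F) :=
  Fintype.ofFinite _

open Projectivization Matrix

section basics

variable {F : Type*} [Field F]

lemma incid_iff (p l : PG F) : Incid p l ↔ p.rep ⬝ᵥ l.rep = 0 := Iff.rfl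

lemma incid_comm (p l : PG F) : Incid p l ↔ Incid l p := by
  rw [incid_iff, incid_iff, dotProduct_comm]

lemma rep_mk_dot (φ : Fin 3 → F) (hφ : φ ≠ 0) (v : Fin 3 → F) :
    v ⬝ᵥ (mk F φ hφ).rep = 0 ↔ v ⬝ᵥ φ = 0 := by
  obtain ⟨a, ha⟩ := exists_smul_eq_mk_rep F φ hφ
  rw [← ha, Units.smul_def, dotProduct_smul, smul_eq_mul]
  simp

lemma incid_mk (p : PG F) (φ : Fin 3 → F) (hφ : φ ≠ 0) :
    Incid p (mk F φ hφ) ↔ p.rep ⬝ᵥ φ = 0 := by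
  rw [incid_iff, rep_mk_dot]

lemma incid_orth (p l : PG F) : Incid p l ↔ p.orthogonal l := by
  conv_rhs => rw [← mk_rep p, ← mk_rep l, orthogonal_mk]
  exact incid_iff p l

lemma eq_or_eq' {a b c d : PG F} (hac : Incid a c) (hbc : Incid b c) (had : Incid a d)
    (hbd : Incid b d) : a = b ∨ c = d := by
  rw [incid_orth] at *
  exact Configuration.ofField.eq_or_eq_of_orthogonal hac hbc had hbd

lemma exists_line (a b : PG F) (h : a ≠ b) : ∃ l : PG F, Incid a l ∧ Incid b l := by
  classical
  refine ⟨cross a b, ?_, ?_⟩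
  · rw [incid_orth]; exact orthogonal_cross_left h
  · rw [incid_orth]; exact orthogonal_cross_right h

end basics

section counting

open scoped Classical

variable {F : Type*} [Field F] [Fintype F]

lemma card_lines_through (x : PG F) :
    (Finset.univ.filter (fun l : PG F => Incid x l)).card = Fintype.card F + 1 := by
  have h1 := Configuration.ProjectivePlane.lineCount_eq (P := PG F) (PG F) x
  have h2 := Configuration.ProjectivePlane.card_points (PG F) (PG F)
  have h3 : Nat.card (PG F) = ∑ i ∈ Finset.range 3, Nat.card F ^ i :=
    Projectivization.card_of_finrank F (Fin 3 → F) (by simp)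
  rw [Nat.card_eq_fintype_card, h2, Nat.card_eq_fintype_card] at h3
  simp only [Finset.sum_range_succ, Finset.range_zero, Finset.sum_empty, pow_zero, pow_one,
    zero_add] at h3
  have h4 : Configuration.ProjectivePlane.order (PG F) (PG F) = Fintype.card F := by
    rcases lt_trichotomy (Configuration.ProjectivePlane.order (PG F) (PG F)) (Fintype.card F)
      with h | h | h
    · nlinarith
    · exact h
    · nlinarith
  rw [h4] at h1
  rw [← h1, Configuration.lineCount, Nat.card_eq_fintype_card, Fintype.card_subtype]
  congr 1
  ext l
  simp only [Finset.mem_filter, Finset.mem_univ, true_and]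
  exact incid_orth x l

/-- Number of points of `S` on the line with coordinate vector `φ`. -/
noncomputable def N (S : Finset (PG F)) (φ : Fin 3 → F) : ℕ :=
  (S.filter (fun p => p.rep ⬝ᵥ φ = 0)).card

lemma N_mk (S : Finset (PG F)) (φ : Fin 3 → F) (hφ : φ ≠ 0) : N S (mk F φ hφ).rep = N S φ := by
  unfold N
  congr 1
  ext p
  simp [rep_mk_dot]

lemma card_lines_two (x p : PG F) (h : p ≠ x) :
    (Finset.univ.filter (fun l : PG F => Incid x l ∧ Incid p l)).card = 1 := by
  obtain ⟨l, h1, h2⟩ := exists_line x p h.symm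
  rw [Finset.card_eq_one]
  refine ⟨l, ?_⟩
  ext m
  simp only [Finset.mem_filter, Finset.mem_univ, true_and, Finset.mem_singleton]
  constructor
  · rintro ⟨h3, h4⟩
    exact (eq_or_eq' h3 h4 h1 h2).resolve_left h.symm
  · rintro rfl; exact ⟨h1, h2⟩

lemma sum_N_through (S : Finset (PG F)) (x : PG F) :
    ∑ l ∈ Finset.univ.filter (fun l : PG F => Incid x l), N S l.rep
      = ∑ p ∈ S, if p = x then Fintype.card F + 1 else 1 := by
  have : ∀ l : PG F, N S l.rep = ∑ p ∈ S, if Incid p l then 1 else 0 := by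
    intro l
    rw [N, Finset.card_filter]
    rfl
  simp_rw [this]
  rw [Finset.sum_comm]
  refine Finset.sum_congr rfl fun p _ => ?_
  rw [← Finset.card_filter, Finset.filter_filter]
  split_ifs with h
  · subst h
    simp only [and_self]
    exact card_lines_through p
  · exact card_lines_two x p h

lemma sum_N_through_not_mem (S : Finset (PG F)) (x : PG F) (hx : x ∉ S) :
    ∑ l ∈ Finset.univ.filter (fun l : PG F => Incid x l), N S l.rep = S.card := by
  rw [sum_N_through, Finset.card_eq_sum_ones]
  refine Finset.sum_congr rfl fun p hp => ?_
  rw [if_neg]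
  rintro rfl
  exact hx hp

/-- Key identity: for a point of a `(q+2)`-set the average line through it is a bisecant. -/
lemma sum_N_sub_two (S : Finset (PG F)) (hS : S.card = Fintype.card F + 2) (x : PG F)
    (hx : x ∈ S) :
    ∑ l ∈ Finset.univ.filter (fun l : PG F => Incid x l), ((N S l.rep : ℤ) - 2) = 0 := by
  rw [Finset.sum_sub_distrib, ← Nat.cast_sum, sum_N_through]
  rw [← Finset.add_sum_erase S _ hx, if_pos rfl]
  have : ∑ p ∈ S.erase x, (if p = x then Fintype.card F + 1 else 1) = Fintype.card F + 1 := by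
    rw [Finset.sum_congr rfl (g := fun _ => 1)]
    · simp [Finset.card_erase_of_mem hx, hS]
    · intro p hp
      rw [if_neg (Finset.ne_of_mem_erase hp)]
  rw [this, Finset.sum_const, card_lines_through]
  push_cast
  simp
  ring

/-- the set of odd lines -/
noncomputable def T (S : Finset (PG F)) : Finset (PG F) :=
  Finset.univ.filter (fun l => Odd (N S l.rep))

/-- cost of a line with `n` points -/
def C (n : ℕ) : ℤ := (n : ℤ) * (n - 2) + (if Odd n then 1 else 0)

lemma card_T (S : Finset (PG F)) (hS : S.card = Fintype.card F + 2) :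
    ((T S).card : ℤ) = ∑ l : PG F, C (N S l.rep) := by
  unfold C
  rw [Finset.sum_add_distrib]
  have h1 : ∑ l : PG F, ((N S l.rep : ℤ) * ((N S l.rep : ℤ) - 2)) = 0 := by
    have : ∀ l : PG F, ((N S l.rep : ℤ) * ((N S l.rep : ℤ) - 2))
        = ∑ p ∈ S, if Incid p l then ((N S l.rep : ℤ) - 2) else 0 := by
      intro l
      rw [← Finset.sum_filter, Finset.sum_const, nsmul_eq_mul]
      rfl
    simp_rw [this]
    rw [Finset.sum_comm]
    refine Finset.sum_eq_zero fun p hp => ?_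
    rw [← Finset.sum_filter]
    exact sum_N_sub_two S hS p hp
  rw [h1, zero_add, T, Finset.card_filter]
  push_cast
  rfl

lemma four_dvd_C (n : ℕ) : (4 : ℤ) ∣ C n := by
  unfold C
  rcases Nat.even_or_odd n with h | h
  · rw [if_neg (by simpa using h)]
    obtain ⟨k, rfl⟩ := h
    push_cast
    exact ⟨k * (k - 1), by ring⟩
  · rw [if_pos h]
    obtain ⟨k, rfl⟩ := h
    push_cast
    exact ⟨k * k, by ring⟩

lemma four_dvd_T (S : Finset (PG F)) (hS : S.card = Fintype.card F + 2) : 4 ∣ (T S).card := by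
  have : (4 : ℤ) ∣ ((T S).card : ℤ) := by
    rw [card_T S hS]
    exact Finset.dvd_sum fun l _ => four_dvd_C _
  exact_mod_cast this

lemma C_nonneg (n : ℕ) : 0 ≤ C n := by
  unfold C
  rcases Nat.lt_or_ge n 2 with h | h
  · interval_cases n <;> simp
  · have : (2 : ℤ) ≤ n := by exact_mod_cast h
    split_ifs <;> nlinarith

lemma C_three : C 3 = 4 := by decide

lemma C_ge (n : ℕ) (h : 4 ≤ n) : 2 * (n : ℤ) ≤ C n := by
  unfold C
  have : (4 : ℤ) ≤ n := by exact_mod_cast h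
  split_ifs <;> nlinarith

/-- A point off `S` lies on an odd line. -/
lemma exists_odd_of_not_mem (hq : Odd (Fintype.card F)) (S : Finset (PG F))
    (hS : S.card = Fintype.card F + 2) (x : PG F) (hx : x ∉ S) :
    ∃ l ∈ T S, Incid x l := by
  by_contra! h
  have h1 := sum_N_through_not_mem S x hx
  have h2 : Even (∑ l ∈ Finset.univ.filter (fun l : PG F => Incid x l), N S l.rep) := by
    refine Finset.even_sum _ fun l hl => ?_
    by_contra h3
    refine h l ?_ (Finset.mem_filter.1 hl).2
    simpa [T] using h3
  rw [h1, hS] at h2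
  rcases hq with ⟨k, hk⟩
  rcases h2 with ⟨m, hm⟩
  omega

/-- nuclei -/
noncomputable def K (S : Finset (PG F)) : Finset (PG F) :=
  S.filter (fun x => ∀ l : PG F, Incid x l → N S l.rep = 2)

lemma N_pos {S : Finset (PG F)} {x l : PG F} (hx : x ∈ S) (h : Incid x l) : 1 ≤ N S l.rep :=
  Finset.card_pos.2 ⟨x, Finset.mem_filter.2 ⟨hx, h⟩⟩

lemma all_two (S : Finset (PG F)) (hS : S.card = Fintype.card F + 2) (x : PG F) (hx : x ∈ S)
    (h : (∀ l, Incid x l → 2 ≤ N S l.rep) ∨ (∀ l, Incid x l → N S l.rep ≤ 2)) : x ∈ K S := by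
  refine Finset.mem_filter.2 ⟨hx, fun l hl => ?_⟩
  have h0 := sum_N_sub_two S hS x hx
  rcases h with h | h
  · have h1 := (Finset.sum_eq_zero_iff_of_nonneg (fun l hl => by
      have := h l (Finset.mem_filter.1 hl).2
      omega)).1 h0 l (Finset.mem_filter.2 ⟨Finset.mem_univ _, hl⟩)
    omega
  · have h1 := (Finset.sum_eq_zero_iff_of_nonpos (fun l hl => by
      have := h l (Finset.mem_filter.1 hl).2
      omega)).1 h0 l (Finset.mem_filter.2 ⟨Finset.mem_univ _, hl⟩)
    omega

lemma exists_odd_of_not_nucleus (S : Finset (PG F))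
    (hS : S.card = Fintype.card F + 2) (x : PG F) (hx : x ∈ S) (hK : x ∉ K S) :
    ∃ l ∈ T S, Incid x l := by
  by_contra! h
  refine hK (all_two S hS x hx (Or.inl fun l hl => ?_))
  have h1 : Even (N S l.rep) := by
    by_contra h3
    refine h l ?_ hl
    simpa [T] using h3
  have h2 := N_pos hx hl
  rcases h1 with ⟨m, hm⟩
  omega

lemma exists_long_of_not_nucleus (S : Finset (PG F))
    (hS : S.card = Fintype.card F + 2) (x : PG F) (hx : x ∈ S) (hK : x ∉ K S) :
    ∃ l, 3 ≤ N S l.rep ∧ Incid x l := by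
  by_contra! h
  refine hK (all_two S hS x hx (Or.inr fun l hl => ?_))
  by_contra h3
  exact h l (by omega) hl

end counting

section products

open scoped Classical

variable {F : Type*} [Field F] [Fintype F]

lemma prod_erase_zero : ∏ c ∈ (Finset.univ : Finset F).erase 0, c = -1 := by
  have h := FiniteField.prod_univ_units_id_eq_neg_one (K := F)
  have h2 : ((∏ x : Fˣ, x : Fˣ) : F) = -1 := by rw [h]; simp
  rw [← h2, Units.coe_prod]
  symm
  refine Finset.prod_bij (fun (a : Fˣ) _ => (a : F)) ?_ ?_ ?_ ?_
  · intro a _; simp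
  · intro a _ b _ hab; exact Units.ext hab
  · intro b hb
    have hb0 : b ≠ 0 := by simpa using hb
    exact ⟨Units.mk0 b hb0, Finset.mem_univ _, rfl⟩
  · intro a _; rfl

lemma eq_of_N_two {S : Finset (PG F)} {φ : Fin 3 → F} (h : N S φ = 2) {y z : PG F}
    (hy : y ∈ S) (hz : z ∈ S) (hyz : y ≠ z) (hyφ : y.rep ⬝ᵥ φ = 0) (hzφ : z.rep ⬝ᵥ φ = 0)
    (p : PG F) (hp : p ∈ S) : p.rep ⬝ᵥ φ = 0 ↔ p = y ∨ p = z := by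
  have h1 : ({y, z} : Finset (PG F)) = S.filter (fun p => p.rep ⬝ᵥ φ = 0) := by
    refine Finset.eq_of_subset_of_card_le ?_ ?_
    · intro a ha
      simp only [Finset.mem_insert, Finset.mem_singleton] at ha
      rcases ha with rfl | rfl
      · exact Finset.mem_filter.2 ⟨hy, hyφ⟩
      · exact Finset.mem_filter.2 ⟨hz, hzφ⟩
    · rw [Finset.card_pair hyz]
      exact h.le
  constructor
  · intro h2
    have : p ∈ S.filter (fun p => p.rep ⬝ᵥ φ = 0) := Finset.mem_filter.2 ⟨hp, h2⟩
    rw [← h1] at this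
    simpa using this
  · rintro (rfl | rfl) <;> assumption

lemma exists_other {S : Finset (PG F)} {φ : Fin 3 → F} (h : 2 ≤ N S φ) (y : PG F) :
    ∃ z ∈ S, z ≠ y ∧ z.rep ⬝ᵥ φ = 0 := by
  obtain ⟨z, hz, hzy⟩ := Finset.exists_mem_ne (s := S.filter (fun p : PG F => p.rep ⬝ᵥ φ = 0)) h y
  rw [Finset.mem_filter] at hz
  exact ⟨z, hz.1, hzy, hz.2⟩

/-- Products of ratios of two linear forms through a point of `S`. -/
lemma prod_ratio (S : Finset (PG F)) (y : PG F) (hy : y ∈ S) (u v : Fin 3 → F)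
    (hu : y.rep ⬝ᵥ u = 0) (hv : y.rep ⬝ᵥ v = 0)
    (hind : ∀ p ∈ S, p.rep ⬝ᵥ u = 0 → p.rep ⬝ᵥ v = 0 → p = y) :
    ∏ p ∈ S.filter (fun p => p.rep ⬝ᵥ u ≠ 0 ∧ p.rep ⬝ᵥ v ≠ 0), (p.rep ⬝ᵥ u) / (p.rep ⬝ᵥ v)
      = ∏ c ∈ (Finset.univ : Finset F).erase 0, c ^ (N S (u - c • v) - 1) := by
  rw [← Finset.prod_fiberwise_of_maps_to (t := (Finset.univ : Finset F).erase 0)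
    (g := fun p : PG F => (p.rep ⬝ᵥ u) / (p.rep ⬝ᵥ v))]
  · refine Finset.prod_congr rfl fun c hc => ?_
    have hc0 : c ≠ 0 := by simpa using hc
    rw [Finset.prod_congr rfl (g := fun _ => c), Finset.prod_const]
    · congr 1
      have h1 : S.filter (fun p => p.rep ⬝ᵥ (u - c • v) = 0) = insert y
          ({i ∈ S.filter (fun p => p.rep ⬝ᵥ u ≠ 0 ∧ p.rep ⬝ᵥ v ≠ 0) |
            i.rep ⬝ᵥ u / i.rep ⬝ᵥ v = c}) := by
        ext p
        simp only [Finset.mem_filter, Finset.mem_insert, dotProduct_sub, dotProduct_smul,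
          smul_eq_mul]
        constructor
        · rintro ⟨hp, h2⟩
          by_cases h3 : p.rep ⬝ᵥ v = 0
          · left
            refine hind p hp ?_ h3
            rw [h3] at h2
            simpa using h2
          · right
            have h4 : p.rep ⬝ᵥ u = c * p.rep ⬝ᵥ v := sub_eq_zero.1 h2
            refine ⟨⟨hp, ?_, h3⟩, ?_⟩
            · rw [h4]; exact mul_ne_zero hc0 h3
            · rw [h4]; field_simp
        · rintro (rfl | ⟨⟨hp, h2, h3⟩, h4⟩)
          · exact ⟨hy, by rw [hu, hv]; simp⟩
          · refine ⟨hp, ?_⟩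
            rw [← h4]; field_simp; simp
      rw [N, h1, Finset.card_insert_of_notMem]
      · simp
      · simp [hu]
    · intro p hp
      exact (Finset.mem_filter.1 hp).2
  · intro p hp
    have := (Finset.mem_filter.1 hp).2
    simp only [Finset.mem_erase, Finset.mem_univ, and_true]
    exact div_ne_zero this.1 this.2

lemma sub_smul_ne_zero {S : Finset (PG F)} {y : PG F} {u v : Fin 3 → F}
    (hind : ∀ p ∈ S, p.rep ⬝ᵥ u = 0 → p.rep ⬝ᵥ v = 0 → p = y) (h2 : N S u = 2)
    (c : F) (hc : c ≠ 0) : u - c • v ≠ 0 := by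
  obtain ⟨z, hz, hzy, hzu⟩ := exists_other h2.ge y
  intro h
  have h3 : z.rep ⬝ᵥ (u - c • v) = 0 := by rw [h]; simp
  rw [dotProduct_sub, dotProduct_smul, hzu, zero_sub, neg_eq_zero, smul_eq_mul] at h3
  exact hzy (hind z hz hzu ((mul_eq_zero.1 h3).resolve_left hc))

lemma prod_nucleus (S : Finset (PG F)) (y : PG F) (hy : y ∈ K S) (u v : Fin 3 → F)
    (hu : y.rep ⬝ᵥ u = 0) (hv : y.rep ⬝ᵥ v = 0) (h2 : N S u = 2)
    (hind : ∀ p ∈ S, p.rep ⬝ᵥ u = 0 → p.rep ⬝ᵥ v = 0 → p = y) :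
    ∏ p ∈ S.filter (fun p => p.rep ⬝ᵥ u ≠ 0 ∧ p.rep ⬝ᵥ v ≠ 0), (p.rep ⬝ᵥ u) / (p.rep ⬝ᵥ v)
      = -1 := by
  obtain ⟨hyS, hy2⟩ := Finset.mem_filter.1 hy
  rw [prod_ratio S y hyS u v hu hv hind, ← prod_erase_zero]
  refine Finset.prod_congr rfl fun c hc => ?_
  have hc0 : c ≠ 0 := by simpa using hc
  have hne := sub_smul_ne_zero hind h2 c hc0
  have h3 := hy2 (mk F _ hne) ((incid_mk y _ hne).2 (by
    rw [dotProduct_sub, dotProduct_smul, hu, hv]; simp))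
  rw [N_mk] at h3
  rw [h3]; simp

/-- `y` lies on a unique 3-secant (joining it to `s`), on a unique tangent (joining it to `t`),
and otherwise only on bisecants. -/
def PA (S : Finset (PG F)) (y s t : Fin 3 → F) : Prop :=
  ∀ φ : Fin 3 → F, φ ≠ 0 → y ⬝ᵥ φ = 0 →
    (s ⬝ᵥ φ = 0 → N S φ = 3) ∧ (t ⬝ᵥ φ = 0 → N S φ = 1) ∧
    (s ⬝ᵥ φ ≠ 0 → t ⬝ᵥ φ ≠ 0 → N S φ = 2)

lemma PA.ne {S : Finset (PG F)} {y s t : Fin 3 → F} (h : PA S y s t) {φ : Fin 3 → F}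
    (hφ : φ ≠ 0) (hy : y ⬝ᵥ φ = 0) (h2 : N S φ = 2) : s ⬝ᵥ φ ≠ 0 ∧ t ⬝ᵥ φ ≠ 0 := by
  obtain ⟨h3, h4, -⟩ := h φ hφ hy
  constructor
  · intro h5; have := h3 h5; omega
  · intro h5; have := h4 h5; omega

lemma ne_zero_of_N_two {S : Finset (PG F)} (hS : S.card ≠ 2) {φ : Fin 3 → F}
    (h : N S φ = 2) : φ ≠ 0 := by
  rintro rfl
  apply hS
  rw [← h, N]
  congr 1
  ext p
  simp

lemma prod_PA (S : Finset (PG F)) (hS : S.card ≠ 2) (y : PG F) (hyS : y ∈ S)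
    (s t : Fin 3 → F) (hA : PA S y.rep s t) (u v : Fin 3 → F)
    (hu : y.rep ⬝ᵥ u = 0) (hv : y.rep ⬝ᵥ v = 0) (h2 : N S u = 2) (h2v : N S v = 2)
    (hind : ∀ p ∈ S, p.rep ⬝ᵥ u = 0 → p.rep ⬝ᵥ v = 0 → p = y) :
    (∏ p ∈ S.filter (fun p => p.rep ⬝ᵥ u ≠ 0 ∧ p.rep ⬝ᵥ v ≠ 0),
      (p.rep ⬝ᵥ u) / (p.rep ⬝ᵥ v)) * ((t ⬝ᵥ u) / (t ⬝ᵥ v)) = - ((s ⬝ᵥ u) / (s ⬝ᵥ v)) := by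
  obtain ⟨hsu, htu⟩ := hA.ne (ne_zero_of_N_two hS h2) hu h2
  obtain ⟨hsv, htv⟩ := hA.ne (ne_zero_of_N_two hS h2v) hv h2v
  rw [prod_ratio S y hyS u v hu hv hind]
  set cs := (s ⬝ᵥ u) / (s ⬝ᵥ v) with hcs
  set ct := (t ⬝ᵥ u) / (t ⬝ᵥ v) with hct
  have hcs0 : cs ≠ 0 := div_ne_zero hsu hsv
  have hct0 : ct ≠ 0 := div_ne_zero htu htv
  have e1 : ∏ c ∈ (Finset.univ : Finset F).erase 0, (if c = ct then c else 1) = ct := by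
    rw [Finset.prod_ite_eq' _ ct (fun c => c)]
    simp [hct0]
  have e2 : ∏ c ∈ (Finset.univ : Finset F).erase 0, (if c = cs then c else 1) = cs := by
    rw [Finset.prod_ite_eq' _ cs (fun c => c)]
    simp [hcs0]
  rw [neg_eq_neg_one_mul, ← prod_erase_zero (F := F)]
  conv_lhs => rw [← e1]
  conv_rhs => rw [← e2]
  rw [← Finset.prod_mul_distrib, ← Finset.prod_mul_distrib]
  refine Finset.prod_congr rfl fun c hc => ?_
  have hc0 : c ≠ 0 := by simpa using hc
  have hne := sub_smul_ne_zero hind h2 c hc0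
  have hy0 : y.rep ⬝ᵥ (u - c • v) = 0 := by
    rw [dotProduct_sub, dotProduct_smul, hu, hv]; simp
  obtain ⟨h3, h4, h5⟩ := hA _ hne hy0
  have i1 : s ⬝ᵥ (u - c • v) = 0 ↔ c = cs := by
    rw [dotProduct_sub, dotProduct_smul, smul_eq_mul, hcs, eq_div_iff hsv, sub_eq_zero, eq_comm]
  have i2 : t ⬝ᵥ (u - c • v) = 0 ↔ c = ct := by
    rw [dotProduct_sub, dotProduct_smul, smul_eq_mul, hct, eq_div_iff htv, sub_eq_zero, eq_comm]
  rw [i1] at h3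
  rw [i2] at h4
  rw [ne_eq, ne_eq, i1, i2] at h5
  by_cases j1 : c = cs
  · have h3' := h3 j1
    have j2 : ¬ c = ct := fun j2 => by have := h4 j2; omega
    rw [if_pos j1, if_neg j2, h3']
    ring
  · by_cases j2 : c = ct
    · rw [if_neg j1, if_pos j2, h4 j2]; ring
    · rw [if_neg j1, if_neg j2, h5 j1 j2]; ring

/-- There are at most two nuclei. -/
lemma card_K_le (hq : (2 : F) ≠ 0) (S : Finset (PG F)) : (K S).card ≤ 2 := by
  by_contra! hK
  obtain ⟨x, y, z, hx, hy, hz, hxy, hxz, hyz⟩ := Finset.two_lt_card_iff.1 hK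
  obtain ⟨hxS, hx2⟩ := Finset.mem_filter.1 hx
  obtain ⟨hyS, hy2⟩ := Finset.mem_filter.1 hy
  obtain ⟨hzS, hz2⟩ := Finset.mem_filter.1 hz
  obtain ⟨a, hya, hza⟩ := exists_line y z hyz
  obtain ⟨b, hxb, hzb⟩ := exists_line x z hxz
  obtain ⟨c, hxc, hyc⟩ := exists_line x y hxy
  have ia := eq_of_N_two (hy2 a hya) hyS hzS hyz hya hza
  have ib := eq_of_N_two (hx2 b hxb) hxS hzS hxz hxb hzb
  have ic := eq_of_N_two (hx2 c hxc) hxS hyS hxy hxc hyc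
  have p1 := prod_nucleus S x hx b.rep c.rep hxb hxc (hx2 b hxb) (by
    intro p hp h1 h2; rw [ib p hp] at h1; rw [ic p hp] at h2; grind)
  have p2 := prod_nucleus S y hy c.rep a.rep hyc hya (hy2 c hyc) (by
    intro p hp h1 h2; rw [ic p hp] at h1; rw [ia p hp] at h2; grind)
  have p3 := prod_nucleus S z hz a.rep b.rep hza hzb (hz2 a hza) (by
    intro p hp h1 h2; rw [ia p hp] at h1; rw [ib p hp] at h2; grind)
  have f1 : S.filter (fun p => p.rep ⬝ᵥ b.rep ≠ 0 ∧ p.rep ⬝ᵥ c.rep ≠ 0)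
      = S.filter (fun p => ¬ (p = x ∨ p = y ∨ p = z)) := by
    refine Finset.filter_congr fun p hp => ?_
    rw [ne_eq, ne_eq, ib p hp, ic p hp]; tauto
  have f2 : S.filter (fun p => p.rep ⬝ᵥ c.rep ≠ 0 ∧ p.rep ⬝ᵥ a.rep ≠ 0)
      = S.filter (fun p => ¬ (p = x ∨ p = y ∨ p = z)) := by
    refine Finset.filter_congr fun p hp => ?_
    rw [ne_eq, ne_eq, ia p hp, ic p hp]; tauto
  have f3 : S.filter (fun p => p.rep ⬝ᵥ a.rep ≠ 0 ∧ p.rep ⬝ᵥ b.rep ≠ 0)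
      = S.filter (fun p => ¬ (p = x ∨ p = y ∨ p = z)) := by
    refine Finset.filter_congr fun p hp => ?_
    rw [ne_eq, ne_eq, ia p hp, ib p hp]; tauto
  rw [f1] at p1
  rw [f2] at p2
  rw [f3] at p3
  have h1 : (1 : F) = (-1) * (-1) * (-1) := by
    conv_rhs => enter [1, 1]; rw [← p1]
    conv_rhs => enter [1, 2]; rw [← p2]
    conv_rhs => enter [2]; rw [← p3]
    rw [← Finset.prod_mul_distrib, ← Finset.prod_mul_distrib]
    symm
    refine Finset.prod_eq_one fun p hp => ?_
    obtain ⟨hp, hn⟩ := Finset.mem_filter.1 hp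
    have na : p.rep ⬝ᵥ a.rep ≠ 0 := by rw [ne_eq, ia p hp]; tauto
    have nb : p.rep ⬝ᵥ b.rep ≠ 0 := by rw [ne_eq, ib p hp]; tauto
    have nc : p.rep ⬝ᵥ c.rep ≠ 0 := by rw [ne_eq, ic p hp]; tauto
    field_simp
  apply hq
  linear_combination h1

end products

section frames

open scoped Classical

variable {F : Type*} [Field F] [Fintype F]

/-- `l` is a 3-secant whose points lie on no other line with at least three points. -/
def Full (S : Finset (PG F)) (l : PG F) : Prop :=
  N S l.rep = 3 ∧ ∀ x ∈ S, Incid x l → ∀ l', Incid x l' → 3 ≤ N S l'.rep → l' = l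

lemma exists_other_point (m x : PG F) : ∃ t : PG F, t ≠ x ∧ Incid t m := by
  have h := card_lines_through m
  have h1 : 1 < (Finset.univ.filter (fun l : PG F => Incid m l)).card := by
    rw [h]
    have := Fintype.card_pos (α := F)
    omega
  obtain ⟨t, ht, htx⟩ := Finset.exists_mem_ne h1 x
  exact ⟨t, htx, (incid_comm _ _).1 (Finset.mem_filter.1 ht).2⟩

lemma full_PA (S : Finset (PG F)) (hS : S.card = Fintype.card F + 2) (l : PG F)
    (hl : Full S l) (x : PG F) (hx : x ∈ S) (hxl : Incid x l) (y : PG F) (hyx : y ≠ x)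
    (hyl : Incid y l) : ∃ t : Fin 3 → F, PA S x.rep y.rep t ∧
      ∃ φ : Fin 3 → F, φ ≠ 0 ∧ x.rep ⬝ᵥ φ = 0 ∧ N S φ = 1 := by
  have h0 := sum_N_sub_two S hS x hx
  have hlm : l ∈ Finset.univ.filter (fun l : PG F => Incid x l) :=
    Finset.mem_filter.2 ⟨Finset.mem_univ _, hxl⟩
  rw [← Finset.add_sum_erase _ _ hlm, hl.1] at h0
  have h1 : ∑ k ∈ (Finset.univ.filter (fun l : PG F => Incid x l)).erase l,
      ((N S k.rep : ℤ) - 2) =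
      ∑ k ∈ (Finset.univ.filter (fun l : PG F => Incid x l)).erase l,
        - (if N S k.rep = 1 then 1 else 0 : ℤ) := by
    refine Finset.sum_congr rfl fun k hk => ?_
    obtain ⟨hkl, hk⟩ := Finset.mem_erase.1 hk
    have hk := (Finset.mem_filter.1 hk).2
    have p1 := N_pos hx hk
    have p2 : N S k.rep < 3 := by
      by_contra! h3
      exact hkl (hl.2 x hx hxl k hk h3)
    split_ifs with h4
    · rw [h4]; norm_num
    · have : N S k.rep = 2 := by omega
      rw [this]; norm_num
  rw [h1, Finset.sum_neg_distrib, ← Nat.cast_one (R := ℤ), ← Nat.cast_zero (R := ℤ)] at h0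
  have h2 : (((Finset.univ.filter (fun l : PG F => Incid x l)).erase l).filter
      (fun k => N S k.rep = 1)).card = 1 := by
    rw [Finset.card_filter]
    push_cast at h0
    have h5 : ((∑ k ∈ (Finset.univ.filter (fun l : PG F => Incid x l)).erase l,
        (if N S k.rep = 1 then 1 else 0) : ℕ) : ℤ) = 1 := by
      push_cast
      linarith
    exact_mod_cast h5
  obtain ⟨m, hm⟩ := Finset.card_eq_one.1 h2
  have hm' : ∀ k : PG F, Incid x k → k ≠ l → (N S k.rep = 1 ↔ k = m) := by
    intro k hk hkl
    have : k ∈ (((Finset.univ.filter (fun l : PG F => Incid x l)).erase l).filter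
      (fun k => N S k.rep = 1)) ↔ k = m := by rw [hm]; simp
    rw [← this]
    simp [hk, hkl]
  have hmm : m ∈ (((Finset.univ.filter (fun l : PG F => Incid x l)).erase l).filter
      (fun k => N S k.rep = 1)) := by rw [hm]; simp
  simp only [Finset.mem_filter, Finset.mem_erase, Finset.mem_univ, true_and] at hmm
  obtain ⟨⟨hml, hxm⟩, hm1⟩ := hmm
  obtain ⟨t, htx, htm⟩ := exists_other_point m x
  refine ⟨t.rep, ?_, m.rep, m.rep_nonzero, hxm, hm1⟩
  intro φ hφ hxφ
  have hxk : Incid x (mk F φ hφ) := (incid_mk x φ hφ).2 hxφ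
  refine ⟨fun h => ?_, fun h => ?_, fun h h' => ?_⟩
  · have hyk : Incid y (mk F φ hφ) := (incid_mk y φ hφ).2 h
    have := (eq_or_eq' hxk hyk hxl hyl).resolve_left hyx.symm
    rw [← N_mk S φ hφ, this, hl.1]
  · have hyk : Incid t (mk F φ hφ) := (incid_mk t φ hφ).2 h
    have := (eq_or_eq' hxk hyk hxm htm).resolve_left htx.symm
    rw [← N_mk S φ hφ, this, hm1]
  · have n1 : mk F φ hφ ≠ l := by
      rintro rfl
      exact h ((incid_mk y φ hφ).1 hyl)
    have n2 : mk F φ hφ ≠ m := by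
      rintro rfl
      exact h' ((incid_mk t φ hφ).1 htm)
    have p1 := N_pos hx hxk
    have p2 : N S (mk F φ hφ).rep < 3 := by
      by_contra! h3
      exact n1 (hl.2 x hx hxl _ hxk h3)
    have p3 : N S (mk F φ hφ).rep ≠ 1 := fun h => n2 ((hm' _ hxk n1).1 h)
    rw [← N_mk S φ hφ]
    omega

lemma eq_of_N_one {S : Finset (PG F)} {φ : Fin 3 → F} (h : N S φ = 1) {e p : PG F}
    (he : e ∈ S) (hp : p ∈ S) (h1 : e.rep ⬝ᵥ φ = 0) (h2 : p.rep ⬝ᵥ φ = 0) : p = e := by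
  refine Finset.card_le_one.1 h.le p ?_ e ?_
  · exact Finset.mem_filter.2 ⟨hp, h2⟩
  · exact Finset.mem_filter.2 ⟨he, h1⟩

/-- coordinate associated with a form `t` relative to `w` -/
noncomputable def g (t w : Fin 3 → F) (p : PG F) : F := (p.rep ⬝ᵥ t) / (p.rep ⬝ᵥ w)

/-- `t / w` maps the points of `S` off `w` bijectively onto the nonzero elements -/
def Bij (S : Finset (PG F)) (w t : Fin 3 → F) : Prop :=
  Set.InjOn (g t w) (S.filter (fun p => p.rep ⬝ᵥ w ≠ 0)) ∧
  (S.filter (fun p => p.rep ⬝ᵥ w ≠ 0)).image (g t w) = (Finset.univ : Finset F).erase 0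

lemma bij_of_full (S : Finset (PG F)) (hS : S.card = Fintype.card F + 2) (l : PG F)
    (hl : Full S l) (e : PG F) (he : e ∈ S) (hel : Incid e l) (t : Fin 3 → F)
    (h1 : N S t = 1) (het : e.rep ⬝ᵥ t = 0) : Bij S l.rep t := by
  have hinj : Set.InjOn (g t l.rep) (S.filter (fun p => p.rep ⬝ᵥ l.rep ≠ 0)) := by
    intro p hp p' hp' hpp
    simp only [Finset.coe_filter, Set.mem_ofPred_eq] at hp hp'
    obtain ⟨hpS, hpw⟩ := hp
    obtain ⟨hpS', hpw'⟩ := hp'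
    by_contra hne
    set c := g t l.rep p with hc
    obtain ⟨e', he', hee', hel'⟩ := exists_other (S := S) (φ := l.rep) (by rw [hl.1]; norm_num) e
    have het' : e'.rep ⬝ᵥ t ≠ 0 := fun h => hee' (eq_of_N_one h1 he he' het h)
    have v' : e'.rep ⬝ᵥ (t - c • l.rep) ≠ 0 := by
      rw [dotProduct_sub, dotProduct_smul, hel']; simpa using het'
    have hne0 : t - c • l.rep ≠ 0 := by
      intro h; apply v'; rw [h]; simp
    have ve : e.rep ⬝ᵥ (t - c • l.rep) = 0 := by
      rw [dotProduct_sub, dotProduct_smul, het, (incid_iff e l).1 hel]; simp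
    have vp : p.rep ⬝ᵥ (t - c • l.rep) = 0 := by
      rw [dotProduct_sub, dotProduct_smul, hc, g, smul_eq_mul]; field_simp; simp
    have vp' : p'.rep ⬝ᵥ (t - c • l.rep) = 0 := by
      rw [dotProduct_sub, dotProduct_smul, hpp, g, smul_eq_mul]; field_simp; simp
    have n3 : 3 ≤ N S (t - c • l.rep) := by
      have hsub : ({e, p, p'} : Finset (PG F)) ⊆
          S.filter (fun p => p.rep ⬝ᵥ (t - c • l.rep) = 0) := by
        intro r hr
        simp only [Finset.mem_insert, Finset.mem_singleton] at hr
        rcases hr with rfl | rfl | rfl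
        · exact Finset.mem_filter.2 ⟨he, ve⟩
        · exact Finset.mem_filter.2 ⟨hpS, vp⟩
        · exact Finset.mem_filter.2 ⟨hpS', vp'⟩
      have hc3 : ({e, p, p'} : Finset (PG F)).card = 3 := by
        rw [Finset.card_eq_three]
        refine ⟨e, p, p', ?_, ?_, hne, rfl⟩
        · rintro rfl; exact hpw hel
        · rintro rfl; exact hpw' hel
      have h6 := Finset.card_le_card hsub
      rw [hc3] at h6
      exact h6
    have h5 := hl.2 e he hel (mk F _ hne0) ((incid_mk _ _ _).2 ve) (by rwa [N_mk])
    apply v'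
    rw [← incid_mk _ _ hne0, h5]
    exact hel'
  refine ⟨hinj, ?_⟩
  refine Finset.eq_of_subset_of_card_le ?_ ?_
  · intro c hc
    obtain ⟨p, hp, rfl⟩ := Finset.mem_image.1 hc
    obtain ⟨hpS, hpw⟩ := Finset.mem_filter.1 hp
    simp only [Finset.mem_erase, Finset.mem_univ, and_true]
    refine div_ne_zero (fun h => ?_) hpw
    have := eq_of_N_one h1 he hpS het h
    subst this
    exact hpw hel
  · rw [Finset.card_image_of_injOn hinj, Finset.card_erase_of_mem (Finset.mem_univ _),
      Finset.card_univ]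
    have h3 := Finset.card_filter_add_card_filter_not (s := S)
      (fun p : PG F => p.rep ⬝ᵥ l.rep = 0)
    have h4 := hl.1
    rw [N] at h4
    rw [h4, hS] at h3
    simp only [ne_eq]
    omega

lemma sum_erase_zero (h3 : 3 ≤ Fintype.card F) :
    ∑ c ∈ (Finset.univ : Finset F).erase 0, c = 0 := by
  have := FiniteField.sum_pow_lt_card_sub_one F 1 (by omega)
  simp only [pow_one] at this
  have h := Finset.add_sum_erase _ (fun c : F => c) (Finset.mem_univ 0)
  rw [this, zero_add] at h
  exact h

lemma Bij.sum {S : Finset (PG F)} {w t : Fin 3 → F} (h : Bij S w t) (f : F → F) :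
    ∑ p ∈ S.filter (fun p => p.rep ⬝ᵥ w ≠ 0), f (g t w p) =
      ∑ c ∈ (Finset.univ : Finset F).erase 0, f c := by
  rw [← h.2, Finset.sum_image h.1]

/-- Coordinate frame attached to a full 3-secant. -/
structure Frame (S : Finset (PG F)) (w t₁ t₂ : Fin 3 → F) (e₁ e₂ e₃ : PG F) : Prop where
  m1 : e₁ ∈ S
  m2 : e₂ ∈ S
  m3 : e₃ ∈ S
  d12 : e₁ ≠ e₂
  d13 : e₁ ≠ e₃
  d23 : e₂ ≠ e₃
  on : ∀ p ∈ S, p.rep ⬝ᵥ w = 0 ↔ p = e₁ ∨ p = e₂ ∨ p = e₃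
  z1 : e₁.rep ⬝ᵥ t₁ = 0
  z2 : e₂.rep ⬝ᵥ t₂ = 0
  z3 : e₃.rep ⬝ᵥ t₁ + e₃.rep ⬝ᵥ t₂ = 0
  n12 : e₂.rep ⬝ᵥ t₁ ≠ 0
  n13 : e₃.rep ⬝ᵥ t₁ ≠ 0
  n21 : e₁.rep ⬝ᵥ t₂ ≠ 0
  n23 : e₃.rep ⬝ᵥ t₂ ≠ 0
  b1 : Bij S w t₁
  b2 : Bij S w t₂
  b3 : Bij S w (t₁ + t₂)

lemma N_smul (S : Finset (PG F)) (φ : Fin 3 → F) (c : F) (hc : c ≠ 0) :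
    N S (c • φ) = N S φ := by
  unfold N
  congr 1
  ext p
  simp [hc]

/-- a form vanishing at two points of a line is a multiple of the line -/
lemma eq_smul_of_two (l : PG F) (x y : PG F) (hxy : x ≠ y) (hx : Incid x l) (hy : Incid y l)
    (φ : Fin 3 → F) (hφx : x.rep ⬝ᵥ φ = 0) (hφy : y.rep ⬝ᵥ φ = 0) :
    ∃ d : F, φ = d • l.rep := by
  by_cases h : φ = 0
  · exact ⟨0, by simp [h]⟩
  · have := (eq_or_eq' ((incid_mk x φ h).2 hφx) ((incid_mk y φ h).2 hφy) hx hy).resolve_left hxy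
    rw [← mk_rep l, mk_eq_mk_iff'] at this
    obtain ⟨a, ha⟩ := this
    exact ⟨a, ha.symm⟩

lemma exists_frame (S : Finset (PG F)) (hS : S.card = Fintype.card F + 2)
    (h3 : 3 ≤ Fintype.card F) (l : PG F) (hl : Full S l) :
    ∃ t₁ t₂ e₁ e₂ e₃, Frame S l.rep t₁ t₂ e₁ e₂ e₃ := by
  have hl3 := hl.1
  rw [N, Finset.card_eq_three] at hl3
  obtain ⟨e₁, e₂, e₃, d12, d13, d23, he⟩ := hl3
  have on : ∀ p ∈ S, p.rep ⬝ᵥ l.rep = 0 ↔ p = e₁ ∨ p = e₂ ∨ p = e₃ := by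
    intro p hp
    have : p ∈ S.filter (fun p => p.rep ⬝ᵥ l.rep = 0) ↔ p = e₁ ∨ p = e₂ ∨ p = e₃ := by
      rw [he]; simp
    rw [← this]
    simp [hp]
  have mem : ∀ p, (p = e₁ ∨ p = e₂ ∨ p = e₃) → p ∈ S ∧ p.rep ⬝ᵥ l.rep = 0 := by
    intro p hp
    have : p ∈ S.filter (fun p => p.rep ⬝ᵥ l.rep = 0) := by rw [he]; simpa using hp
    exact Finset.mem_filter.1 this
  obtain ⟨m1, l1⟩ := mem e₁ (by simp)
  obtain ⟨m2, l2⟩ := mem e₂ (by simp)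
  obtain ⟨m3, l3⟩ := mem e₃ (by simp)
  obtain ⟨-, -, f₁, hf1, z1, o1⟩ := full_PA S hS l hl e₁ m1 l1 e₂ d12.symm l2
  obtain ⟨-, -, f₂, hf2, z2, o2⟩ := full_PA S hS l hl e₂ m2 l2 e₁ d12 l1
  obtain ⟨-, -, f₃, hf3, z3, o3⟩ := full_PA S hS l hl e₃ m3 l3 e₁ d13 l1
  have n12 : e₂.rep ⬝ᵥ f₁ ≠ 0 := fun h => d12 (eq_of_N_one o1 m1 m2 z1 h).symm
  have n13 : e₃.rep ⬝ᵥ f₁ ≠ 0 := fun h => d13 (eq_of_N_one o1 m1 m3 z1 h).symm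
  have n21 : e₁.rep ⬝ᵥ f₂ ≠ 0 := fun h => d12 (eq_of_N_one o2 m2 m1 z2 h)
  have n23 : e₃.rep ⬝ᵥ f₂ ≠ 0 := fun h => d23 (eq_of_N_one o2 m2 m3 z2 h).symm
  have n31 : e₁.rep ⬝ᵥ f₃ ≠ 0 := fun h => d13 (eq_of_N_one o3 m3 m1 z3 h)
  set t₁ := (e₃.rep ⬝ᵥ f₂) • f₁ with ht1
  set t₂ := (- (e₃.rep ⬝ᵥ f₁)) • f₂ with ht2
  have n13' : - (e₃.rep ⬝ᵥ f₁) ≠ 0 := neg_ne_zero.2 n13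
  have E1 : ∀ p : PG F, p.rep ⬝ᵥ t₁ = (e₃.rep ⬝ᵥ f₂) * (p.rep ⬝ᵥ f₁) := by
    intro p; rw [ht1, dotProduct_smul, smul_eq_mul]
  have E2 : ∀ p : PG F, p.rep ⬝ᵥ t₂ = (- (e₃.rep ⬝ᵥ f₁)) * (p.rep ⬝ᵥ f₂) := by
    intro p; rw [ht2, dotProduct_smul, smul_eq_mul]
  have b1 : Bij S l.rep t₁ := bij_of_full S hS l hl e₁ m1 l1 t₁
    (by rw [ht1, N_smul _ _ _ n23, o1]) (by rw [E1, z1, mul_zero])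
  have b2 : Bij S l.rep t₂ := bij_of_full S hS l hl e₂ m2 l2 t₂
    (by rw [ht2, N_smul _ _ _ n13', o2]) (by rw [E2, z2, mul_zero])
  have zz3 : e₃.rep ⬝ᵥ t₁ + e₃.rep ⬝ᵥ t₂ = 0 := by rw [E1, E2]; ring
  have n21' : e₁.rep ⬝ᵥ t₂ ≠ 0 := by rw [E2]; exact mul_ne_zero n13' n21
  set c := (e₁.rep ⬝ᵥ t₂) / (e₁.rep ⬝ᵥ f₃) with hc
  have hc0 : c ≠ 0 := div_ne_zero n21' n31
  obtain ⟨d, hd⟩ := eq_smul_of_two l e₁ e₃ d13 l1 l3 (t₁ + t₂ - c • f₃)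
    (by have h9 : e₁.rep ⬝ᵥ (c • f₃) = e₁.rep ⬝ᵥ t₂ := by
          rw [dotProduct_smul c, smul_eq_mul, hc, div_mul_cancel₀ _ n31]
        rw [dotProduct_sub, dotProduct_add, E1, z1, h9]
        ring)
    (by rw [dotProduct_sub, dotProduct_add, zz3, dotProduct_smul, z3]; simp)
  have b3' : Bij S l.rep (c • f₃) := bij_of_full S hS l hl e₃ m3 l3 _
    (by rw [N_smul _ _ _ hc0, o3]) (by rw [dotProduct_smul, z3, smul_zero])
  have key : ∀ p ∈ S.filter (fun p => p.rep ⬝ᵥ l.rep ≠ 0),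
      g t₁ l.rep p + g t₂ l.rep p - g (c • f₃) l.rep p = d := by
    intro p hp
    have hpw := (Finset.mem_filter.1 hp).2
    have := congrArg (fun φ => p.rep ⬝ᵥ φ) hd
    simp only [dotProduct_sub, dotProduct_add, dotProduct_smul, smul_eq_mul] at this
    simp only [g, dotProduct_smul, smul_eq_mul]
    field_simp
    linear_combination this
  have hsum := Finset.sum_congr (rfl : S.filter (fun p => p.rep ⬝ᵥ l.rep ≠ 0) = _) key
  have s1 := b1.sum (fun x => x)
  have s2 := b2.sum (fun x => x)
  have s3 := b3'.sum (fun x => x)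
  rw [sum_erase_zero h3] at s1 s2 s3
  rw [Finset.sum_sub_distrib, Finset.sum_add_distrib, s1, s2, s3] at hsum
  have hcard : (S.filter (fun p => p.rep ⬝ᵥ l.rep ≠ 0)).card + 1 = Fintype.card F := by
    rw [← Finset.card_image_of_injOn b1.1, b1.2, Finset.card_erase_of_mem (Finset.mem_univ _),
      Finset.card_univ]
    omega
  have hcF : ((S.filter (fun p => p.rep ⬝ᵥ l.rep ≠ 0)).card : F) + 1 = 0 := by
    rw [← Nat.cast_one (R := F), ← Nat.cast_add, hcard]
    exact FiniteField.cast_card_eq_zero F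
  rw [Finset.sum_const, nsmul_eq_mul] at hsum
  have hd0 : d = 0 := by
    linear_combination hsum + d * hcF
  rw [hd0, zero_smul, sub_eq_zero] at hd
  refine ⟨t₁, t₂, e₁, e₂, e₃, m1, m2, m3, d12, d13, d23, on, ?_, ?_, zz3, ?_, ?_, n21', ?_,
    b1, b2, ?_⟩
  · rw [E1, z1, mul_zero]
  · rw [E2, z2, mul_zero]
  · rw [E1]; exact mul_ne_zero n23 n12
  · rw [E1]; exact mul_ne_zero n23 n13
  · rw [E2]; exact mul_ne_zero n13' n23
  · rw [hd]; exact b3'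

end frames

section polar

open scoped Classical

variable {F : Type*} [Field F] [Fintype F]

lemma prod_sub_erase (a : F) (ha : a ≠ 0) :
    (∏ c ∈ ((Finset.univ : Finset F).erase 0).erase a, (c - a)) * a = 1 := by
  have h1 : ∏ c ∈ ((Finset.univ : Finset F).erase 0).erase a, (c - a) =
      ∏ d ∈ ((Finset.univ : Finset F).erase 0).erase (-a), d := by
    refine Finset.prod_nbij' (fun c => c - a) (fun d => d + a) ?_ ?_ ?_ ?_ ?_
    · intro c hc
      simp only [Finset.mem_erase, Finset.mem_univ, and_true] at hc ⊢
      refine ⟨fun h => hc.2 ?_, sub_ne_zero.2 hc.1⟩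
      linear_combination h
    · intro d hd
      simp only [Finset.mem_erase, Finset.mem_univ, and_true] at hd ⊢
      refine ⟨fun h => hd.2 ?_, fun h => hd.1 ?_⟩
      · linear_combination h
      · linear_combination h
    · intro c _; ring
    · intro c _; ring
    · intro c _; rfl
  have h2 := Finset.mul_prod_erase ((Finset.univ : Finset F).erase 0) (fun c => c)
    (a := -a) (by simp [ha])
  rw [prod_erase_zero] at h2
  rw [h1]
  linear_combination -h2

lemma Bij.ne_zero {S : Finset (PG F)} {w t : Fin 3 → F} (h : Bij S w t) {y : PG F}
    (hy : y ∈ S) (hyw : y.rep ⬝ᵥ w ≠ 0) : g t w y ≠ 0 := by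
  have : g t w y ∈ (S.filter (fun p => p.rep ⬝ᵥ w ≠ 0)).image (g t w) :=
    Finset.mem_image_of_mem _ (Finset.mem_filter.2 ⟨hy, hyw⟩)
  rw [h.2] at this
  exact (Finset.mem_erase.1 this).1

lemma Bij.inj {S : Finset (PG F)} {w t : Fin 3 → F} (h : Bij S w t) {y z : PG F}
    (hy : y ∈ S) (hyw : y.rep ⬝ᵥ w ≠ 0) (hz : z ∈ S) (hzw : z.rep ⬝ᵥ w ≠ 0)
    (hyz : g t w y = g t w z) : y = z :=
  h.1 (by simp [hy, hyw]) (by simp [hz, hzw]) hyz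

lemma Bij.prod {S : Finset (PG F)} {w t : Fin 3 → F} (h : Bij S w t) {y : PG F}
    (hy : y ∈ S) (hyw : y.rep ⬝ᵥ w ≠ 0) :
    (∏ p ∈ (S.filter (fun p => p.rep ⬝ᵥ w ≠ 0)).erase y, (g t w p - g t w y)) * g t w y = 1 := by
  have hy' : y ∈ S.filter (fun p => p.rep ⬝ᵥ w ≠ 0) := Finset.mem_filter.2 ⟨hy, hyw⟩
  have h0 := h.ne_zero hy hyw
  rw [← prod_sub_erase _ h0]
  congr 1
  have h1 : ((Finset.univ : Finset F).erase 0).erase (g t w y) =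
      ((S.filter (fun p => p.rep ⬝ᵥ w ≠ 0)).erase y).image (g t w) := by
    rw [← h.2]
    ext c
    simp only [Finset.mem_erase, Finset.mem_image]
    constructor
    · rintro ⟨h2, p, hp, rfl⟩
      exact ⟨p, ⟨fun h => h2 (by rw [h]), hp⟩, rfl⟩
    · rintro ⟨p, ⟨hpy, hp⟩, rfl⟩
      exact ⟨fun h3 => hpy (h.1 hp hy' h3), p, hp, rfl⟩
  rw [h1, Finset.prod_image]
  intro p hp p' hp' hpp
  exact h.1 (Finset.mem_of_mem_erase hp) (Finset.mem_of_mem_erase hp') hpp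

/-- one side of a frame -/
structure Side (S : Finset (PG F)) (w t : Fin 3 → F) (e e' e'' : PG F) : Prop where
  m : e ∈ S
  m' : e' ∈ S
  m'' : e'' ∈ S
  d : e ≠ e'
  d' : e ≠ e''
  d'' : e' ≠ e''
  on : ∀ p ∈ S, p.rep ⬝ᵥ w = 0 ↔ p = e ∨ p = e' ∨ p = e''
  b : Bij S w t
  z : e.rep ⬝ᵥ t = 0
  n' : e'.rep ⬝ᵥ t ≠ 0
  n'' : e''.rep ⬝ᵥ t ≠ 0

lemma Frame.side1 {S : Finset (PG F)} {w t₁ t₂ : Fin 3 → F} {e₁ e₂ e₃ : PG F}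
    (h : Frame S w t₁ t₂ e₁ e₂ e₃) : Side S w t₁ e₁ e₂ e₃ :=
  ⟨h.m1, h.m2, h.m3, h.d12, h.d13, h.d23, h.on, h.b1, h.z1, h.n12, h.n13⟩

lemma Frame.side2 {S : Finset (PG F)} {w t₁ t₂ : Fin 3 → F} {e₁ e₂ e₃ : PG F}
    (h : Frame S w t₁ t₂ e₁ e₂ e₃) : Side S w t₂ e₂ e₁ e₃ :=
  ⟨h.m2, h.m1, h.m3, h.d12.symm, h.d23, h.d13, fun p hp => (h.on p hp).trans (by tauto),
    h.b2, h.z2, h.n21, h.n23⟩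

lemma Frame.side3 {S : Finset (PG F)} {w t₁ t₂ : Fin 3 → F} {e₁ e₂ e₃ : PG F}
    (h : Frame S w t₁ t₂ e₁ e₂ e₃) : Side S w (t₁ + t₂) e₃ e₁ e₂ :=
  ⟨h.m3, h.m1, h.m2, h.d13.symm, h.d23.symm, h.d12, fun p hp => (h.on p hp).trans (by tauto),
    h.b3, by rw [dotProduct_add]; exact h.z3, by rw [dotProduct_add, h.z1, zero_add]; exact h.n21,
    by rw [dotProduct_add, h.z2, add_zero]; exact h.n12⟩

lemma Side.swap {S : Finset (PG F)} {w t : Fin 3 → F} {e e' e'' : PG F}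
    (h : Side S w t e e' e'') : Side S w t e e'' e' :=
  ⟨h.m, h.m'', h.m', h.d', h.d, h.d''.symm, fun p hp => (h.on p hp).trans (by tauto),
    h.b, h.z, h.n'', h.n'⟩

/-- The form through `y` and the zero of `t`. -/
noncomputable def U (t w : Fin 3 → F) (y : PG F) : Fin 3 → F := t - g t w y • w

lemma U_dot (t w : Fin 3 → F) (y : PG F) (v : Fin 3 → F) :
    v ⬝ᵥ U t w y = v ⬝ᵥ t - g t w y * (v ⬝ᵥ w) := by
  rw [U, dotProduct_sub, dotProduct_smul, smul_eq_mul]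

lemma U_dot_rep (t w : Fin 3 → F) (y p : PG F) (hp : p.rep ⬝ᵥ w ≠ 0) :
    p.rep ⬝ᵥ U t w y = (p.rep ⬝ᵥ w) * (g t w p - g t w y) := by
  rw [U_dot]
  conv_rhs => rw [g]
  field_simp

lemma Side.zero_iff {S : Finset (PG F)} {w t : Fin 3 → F} {e e' e'' : PG F}
    (h : Side S w t e e' e'') {y : PG F} (hy : y ∈ S) (hyw : y.rep ⬝ᵥ w ≠ 0)
    (p : PG F) (hp : p ∈ S) : p.rep ⬝ᵥ U t w y = 0 ↔ p = y ∨ p = e := by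
  by_cases hw : p.rep ⬝ᵥ w = 0
  · have hpy : p ≠ y := by rintro rfl; exact hyw hw
    rw [U_dot, hw, mul_zero, sub_zero]
    rcases (h.on p hp).1 hw with rfl | rfl | rfl
    · simp [h.z]
    · simp [h.n', hpy, h.d.symm]
    · simp [h.n'', hpy, h.d'.symm]
  · have hpe : p ≠ e := by rintro rfl; exact hw ((h.on _ hp).2 (Or.inl rfl))
    rw [U_dot_rep _ _ _ _ hw]
    simp only [mul_eq_zero, hw, false_or, hpe, or_false, sub_eq_zero]
    exact ⟨fun h2 => h.b.inj hp hw hy hyw h2, fun h2 => by rw [h2]⟩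

lemma N_eq_two {S : Finset (PG F)} {φ : Fin 3 → F} {y e : PG F} (hy : y ∈ S) (he : e ∈ S)
    (hye : y ≠ e) (h : ∀ p ∈ S, p.rep ⬝ᵥ φ = 0 ↔ p = y ∨ p = e) : N S φ = 2 := by
  rw [N, Finset.card_eq_two]
  refine ⟨y, e, hye, ?_⟩
  ext p
  simp only [Finset.mem_filter, Finset.mem_insert, Finset.mem_singleton]
  constructor
  · rintro ⟨h1, h2⟩; exact (h p h1).1 h2
  · rintro (rfl | rfl)
    · exact ⟨hy, (h _ hy).2 (Or.inl rfl)⟩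
    · exact ⟨he, (h _ he).2 (Or.inr rfl)⟩

lemma Side.ne {S : Finset (PG F)} {w t : Fin 3 → F} {e e' e'' : PG F}
    (h : Side S w t e e' e'') {y : PG F} (hyw : y.rep ⬝ᵥ w ≠ 0) : y ≠ e := by
  rintro rfl; exact hyw ((h.on _ h.m).2 (Or.inl rfl))

lemma Side.ne' {S : Finset (PG F)} {w t : Fin 3 → F} {e e' e'' : PG F}
    (h : Side S w t e e' e'') {y : PG F} (hyw : y.rep ⬝ᵥ w ≠ 0) : y ≠ e' := by
  rintro rfl; exact hyw ((h.on _ h.m').2 (Or.inr (Or.inl rfl)))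

lemma Side.ne'' {S : Finset (PG F)} {w t : Fin 3 → F} {e e' e'' : PG F}
    (h : Side S w t e e' e'') {y : PG F} (hyw : y.rep ⬝ᵥ w ≠ 0) : y ≠ e'' := by
  rintro rfl; exact hyw ((h.on _ h.m'').2 (Or.inr (Or.inr rfl)))

lemma Side.N_U {S : Finset (PG F)} {w t : Fin 3 → F} {e e' e'' : PG F}
    (h : Side S w t e e' e'') {y : PG F} (hy : y ∈ S) (hyw : y.rep ⬝ᵥ w ≠ 0) :
    N S (U t w y) = 2 :=
  N_eq_two hy h.m (h.ne hyw) (h.zero_iff hy hyw)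

lemma Side.dot_ne {S : Finset (PG F)} (hS : S.card ≠ 2) {w t : Fin 3 → F} {e e' e'' : PG F}
    (h : Side S w t e e' e'') {y : PG F} (hy : y ∈ S) (hyw : y.rep ⬝ᵥ w ≠ 0)
    {s τ : Fin 3 → F} (hA : PA S y.rep s τ) (hs : s ⬝ᵥ w = 0) (hτ : τ ⬝ᵥ w = 0) :
    s ⬝ᵥ t ≠ 0 ∧ τ ⬝ᵥ t ≠ 0 := by
  have h1 := hA.ne (ne_zero_of_N_two hS (h.N_U hy hyw))
    ((h.zero_iff hy hyw y hy).2 (Or.inl rfl)) (h.N_U hy hyw)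
  rwa [U_dot, U_dot, hs, hτ, mul_zero, sub_zero, sub_zero] at h1

lemma app {S : Finset (PG F)} (hS : S.card ≠ 2) {w t t' : Fin 3 → F} {e e' e'' : PG F}
    (h : Side S w t e e' e'') (h' : Side S w t' e' e e'') {y : PG F}
    (hy : y ∈ S) (hyw : y.rep ⬝ᵥ w ≠ 0) {s τ : Fin 3 → F} (hA : PA S y.rep s τ)
    (hs : s ⬝ᵥ w = 0) (hτ : τ ⬝ᵥ w = 0) :
    (g t' w y / g t w y) * ((e''.rep ⬝ᵥ t) / (e''.rep ⬝ᵥ t')) * ((τ ⬝ᵥ t) / (τ ⬝ᵥ t'))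
      = - ((s ⬝ᵥ t) / (s ⬝ᵥ t')) := by
  have key := prod_PA S hS y hy s τ hA (U t w y) (U t' w y)
    ((h.zero_iff hy hyw y hy).2 (Or.inl rfl)) ((h'.zero_iff hy hyw y hy).2 (Or.inl rfl))
    (h.N_U hy hyw) (h'.N_U hy hyw) (by
      intro p hp h1 h2
      rw [h.zero_iff hy hyw p hp] at h1
      rw [h'.zero_iff hy hyw p hp] at h2
      rcases h1 with h1 | h1
      · exact h1
      · rcases h2 with h2 | h2
        · exact h2
        · exact absurd (h1.symm.trans h2) h.d)
  have hset : S.filter (fun p => p.rep ⬝ᵥ U t w y ≠ 0 ∧ p.rep ⬝ᵥ U t' w y ≠ 0) =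
      insert e'' ((S.filter (fun p => p.rep ⬝ᵥ w ≠ 0)).erase y) := by
    ext p
    simp only [Finset.mem_filter, Finset.mem_insert, Finset.mem_erase]
    constructor
    · rintro ⟨hp, h1, h2⟩
      rw [ne_eq, h.zero_iff hy hyw p hp] at h1
      rw [ne_eq, h'.zero_iff hy hyw p hp] at h2
      have h3 := h.on p hp
      tauto
    · rintro (rfl | ⟨hpy, hp, hw⟩)
      · refine ⟨h.m'', ?_, ?_⟩
        · rw [ne_eq, h.zero_iff hy hyw _ h.m'']
          have := h.ne'' hyw
          have := h.d'
          tauto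
        · rw [ne_eq, h'.zero_iff hy hyw _ h.m'']
          have := h.ne'' hyw
          have := h.d''
          tauto
      · refine ⟨hp, ?_, ?_⟩
        · rw [ne_eq, h.zero_iff hy hyw p hp]
          have := h.ne hw
          tauto
        · rw [ne_eq, h'.zero_iff hy hyw p hp]
          have := h.ne' hw
          tauto
  have hnot : e'' ∉ (S.filter (fun p => p.rep ⬝ᵥ w ≠ 0)).erase y := by
    intro hm
    have := (Finset.mem_filter.1 (Finset.mem_of_mem_erase hm)).2
    exact this ((h.on _ h.m'').2 (Or.inr (Or.inr rfl)))
  have hw'' : e''.rep ⬝ᵥ w = 0 := (h.on _ h.m'').2 (Or.inr (Or.inr rfl))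
  rw [hset, Finset.prod_insert hnot] at key
  have hprod : ∏ p ∈ (S.filter (fun p => p.rep ⬝ᵥ w ≠ 0)).erase y,
      (p.rep ⬝ᵥ U t w y) / (p.rep ⬝ᵥ U t' w y) = g t' w y / g t w y := by
    have h1 := h.b.prod hy hyw
    have h2 := h'.b.prod hy hyw
    have h3 := h.b.ne_zero hy hyw
    have h4 := h'.b.ne_zero hy hyw
    rw [Finset.prod_congr rfl (g := fun p => (g t w p - g t w y) / (g t' w p - g t' w y)),
      Finset.prod_div_distrib, eq_div_of_mul_eq h3 h1, eq_div_of_mul_eq h4 h2]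
    · field_simp
    · intro p hp
      have hpw := (Finset.mem_filter.1 (Finset.mem_of_mem_erase hp)).2
      rw [U_dot_rep _ _ _ _ hpw, U_dot_rep _ _ _ _ hpw, mul_div_mul_left _ _ hpw]
  rw [hprod] at key
  simp only [U_dot, hs, hτ, hw'', mul_zero, sub_zero] at key
  rw [← key]
  ring

lemma Frame.eqs {S : Finset (PG F)} (hS : S.card ≠ 2) {w t₁ t₂ : Fin 3 → F} {e₁ e₂ e₃ : PG F}
    (h : Frame S w t₁ t₂ e₁ e₂ e₃) {y : PG F}
    (hy : y ∈ S) (hyw : y.rep ⬝ᵥ w ≠ 0) {s τ : Fin 3 → F} (hA : PA S y.rep s τ)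
    (hs : s ⬝ᵥ w = 0) (hτ : τ ⬝ᵥ w = 0) :
    g t₂ w y * (τ ⬝ᵥ t₁) * (s ⬝ᵥ t₂) = g t₁ w y * (s ⬝ᵥ t₁) * (τ ⬝ᵥ t₂) ∧
    (2 * g t₁ w y + g t₂ w y) * (s ⬝ᵥ t₁) + (g t₁ w y + 2 * g t₂ w y) * (s ⬝ᵥ t₂) = 0 := by
  obtain ⟨sx, tx⟩ := h.side1.dot_ne hS hy hyw hA hs hτ
  obtain ⟨sy, ty⟩ := h.side2.dot_ne hS hy hyw hA hs hτ
  obtain ⟨sz, tz⟩ := h.side3.dot_ne hS hy hyw hA hs hτ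
  have a1 := app hS h.side1 h.side2 hy hyw hA hs hτ
  have a2 := app hS h.side1.swap h.side3 hy hyw hA hs hτ
  have g1 := h.b1.ne_zero hy hyw
  have g2 := h.b2.ne_zero hy hyw
  have g3 : g (t₁ + t₂) w y = g t₁ w y + g t₂ w y := by
    simp only [g, dotProduct_add, add_div]
  rw [g3] at a2
  have r3 : (e₃.rep ⬝ᵥ t₁) / (e₃.rep ⬝ᵥ t₂) = -1 := by
    rw [div_eq_iff h.n23]; linear_combination h.z3
  have r2 : (e₂.rep ⬝ᵥ t₁) / (e₂.rep ⬝ᵥ (t₁ + t₂)) = 1 := by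
    rw [dotProduct_add, h.z2, add_zero, div_self h.n12]
  rw [r3] at a1
  rw [r2] at a2
  rw [dotProduct_add] at sz tz
  rw [dotProduct_add, dotProduct_add] at a2
  field_simp at a1 a2
  have e1 : g t₂ w y * (τ ⬝ᵥ t₁) * (s ⬝ᵥ t₂) = g t₁ w y * (s ⬝ᵥ t₁) * (τ ⬝ᵥ t₂) := by
    linear_combination -a1
  refine ⟨e1, ?_⟩
  apply mul_left_cancel₀ tx
  linear_combination a2 + e1

end polar

section fulllines

open scoped Classical

variable {F : Type*} [Field F] [Fintype F]

lemma PA.congr {S : Finset (PG F)} {y s t s' t' : Fin 3 → F} (h : PA S y s t) (c d : F)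
    (hs : s' = s - c • y) (ht : t' = t - d • y) : PA S y s' t' := by
  intro φ hφ hy
  have h1 : s' ⬝ᵥ φ = s ⬝ᵥ φ := by rw [hs, sub_dotProduct, smul_dotProduct, hy]; simp
  have h2 : t' ⬝ᵥ φ = t ⬝ᵥ φ := by rw [ht, sub_dotProduct, smul_dotProduct, hy]; simp
  rw [h1, h2]
  exact h φ hφ hy

/-- data attached to a second full line -/
structure LD (S : Finset (PG F)) (w t₁ t₂ : Fin 3 → F) (l y : PG F) (s τ : Fin 3 → F) : Prop where
  m : y ∈ S
  i : Incid y l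
  yw : y.rep ⬝ᵥ w ≠ 0
  A : PA S y.rep s τ
  sw : s ⬝ᵥ w = 0
  τw : τ ⬝ᵥ w = 0
  quad : (s ⬝ᵥ t₁) ^ 2 + (s ⬝ᵥ t₁) * (s ⬝ᵥ t₂) + (s ⬝ᵥ t₂) ^ 2 = 0

lemma norm_dot (x y w : Fin 3 → F) (h : y ⬝ᵥ w ≠ 0) :
    (x - ((x ⬝ᵥ w) / (y ⬝ᵥ w)) • y) ⬝ᵥ w = 0 := by
  rw [sub_dotProduct, smul_dotProduct, smul_eq_mul, div_mul_cancel₀ _ h, sub_self]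

lemma exists_LD (h2 : (2 : F) ≠ 0) (S : Finset (PG F)) (hS : S.card = Fintype.card F + 2)
    (l₀ : PG F) (hl₀ : Full S l₀) {t₁ t₂ : Fin 3 → F} {e₁ e₂ e₃ : PG F}
    (hF : Frame S l₀.rep t₁ t₂ e₁ e₂ e₃) (l : PG F) (hl : Full S l) (hne : l ≠ l₀) :
    ∃ y s τ, LD S l₀.rep t₁ t₂ l y s τ := by
  have hS2 : S.card ≠ 2 := by
    have := Fintype.card_pos (α := F)
    omega
  have hoff : ∀ y ∈ S, Incid y l → y.rep ⬝ᵥ l₀.rep ≠ 0 := by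
    intro y hy hyl h
    exact hne (hl₀.2 y hy h l hyl hl.1.ge)
  have h3 : 1 < (S.filter (fun p => p.rep ⬝ᵥ l.rep = 0)).card := by
    have := hl.1
    rw [N] at this
    omega
  obtain ⟨y, hy, y', hy', hyy⟩ := Finset.one_lt_card.1 h3
  obtain ⟨hyS, hyl⟩ := Finset.mem_filter.1 hy
  obtain ⟨hyS', hyl'⟩ := Finset.mem_filter.1 hy'
  have w1 := hoff y hyS hyl
  have w2 := hoff y' hyS' hyl'
  obtain ⟨τ, hA, -⟩ := full_PA S hS l hl y hyS hyl y' hyy.symm hyl'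
  obtain ⟨τ', hA', -⟩ := full_PA S hS l hl y' hyS' hyl' y hyy hyl
  have B := hA.congr _ _ rfl (rfl : τ - ((τ ⬝ᵥ l₀.rep) / (y.rep ⬝ᵥ l₀.rep)) • y.rep = _)
    (s' := y'.rep - ((y'.rep ⬝ᵥ l₀.rep) / (y.rep ⬝ᵥ l₀.rep)) • y.rep)
  have B' := hA'.congr _ _ rfl (rfl : τ' - ((τ' ⬝ᵥ l₀.rep) / (y'.rep ⬝ᵥ l₀.rep)) • y'.rep = _)
    (s' := y.rep - ((y.rep ⬝ᵥ l₀.rep) / (y'.rep ⬝ᵥ l₀.rep)) • y'.rep)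
  refine ⟨y, _, _, hyS, hyl, w1, B, norm_dot _ _ _ w1, norm_dot _ _ _ w1, ?_⟩
  obtain ⟨-, E⟩ := hF.eqs hS2 hyS w1 B (norm_dot _ _ _ w1) (norm_dot _ _ _ w1)
  obtain ⟨-, E'⟩ := hF.eqs hS2 hyS' w2 B' (norm_dot _ _ _ w2) (norm_dot _ _ _ w2)
  simp only [sub_dotProduct, smul_dotProduct, smul_eq_mul, g] at E E' ⊢
  generalize y.rep ⬝ᵥ l₀.rep = W at *
  generalize y'.rep ⬝ᵥ l₀.rep = W' at *
  have x1 : ∀ t, y.rep ⬝ᵥ t = W * ((y.rep ⬝ᵥ t) / W) := fun t => by field_simp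
  have x2 : ∀ t, y'.rep ⬝ᵥ t = W' * ((y'.rep ⬝ᵥ t) / W') := fun t => by field_simp
  generalize h11 : (y.rep ⬝ᵥ t₁) / W = a at *
  generalize h12 : (y.rep ⬝ᵥ t₂) / W = b at *
  generalize h21 : (y'.rep ⬝ᵥ t₁) / W' = a' at *
  generalize h22 : (y'.rep ⬝ᵥ t₂) / W' = b' at *
  have y1 : y.rep ⬝ᵥ t₁ = W * a := by rw [← h11]; field_simp
  have y2 : y.rep ⬝ᵥ t₂ = W * b := by rw [← h12]; field_simp
  have y3 : y'.rep ⬝ᵥ t₁ = W' * a' := by rw [← h21]; field_simp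
  have y4 : y'.rep ⬝ᵥ t₂ = W' * b' := by rw [← h22]; field_simp
  rw [y1, y2, y3, y4] at E E' ⊢
  have F1 : (2 * a + b) * (a' - a) + (a + 2 * b) * (b' - b) = 0 := by
    apply mul_left_cancel₀ w2
    rw [mul_zero, ← E]
    field_simp
  have F2 : (2 * a' + b') * (a' - a) + (a' + 2 * b') * (b' - b) = 0 := by
    apply mul_left_cancel₀ w1
    apply neg_injective
    rw [mul_zero, neg_zero, ← E']
    field_simp
    ring
  have F3 : (a' - a) ^ 2 + (a' - a) * (b' - b) + (b' - b) ^ 2 = 0 := by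
    apply mul_left_cancel₀ h2
    linear_combination F2 - F1
  have z1 : W' * a' - W' / W * (W * a) = W' * (a' - a) := by field_simp
  have z2 : W' * b' - W' / W * (W * b) = W' * (b' - b) := by field_simp
  rw [z1, z2]
  linear_combination W' ^ 2 * F3

/-- two full lines with the same direction, characteristic not 3 -/
lemma same_dir (h3 : (3 : F) ≠ 0) (S : Finset (PG F)) (hS2 : S.card ≠ 2)
    {w t₁ t₂ : Fin 3 → F} {e₁ e₂ e₃ : PG F} (hF : Frame S w t₁ t₂ e₁ e₂ e₃)
    (l l' : PG F) (hl : Full S l) (hl' : Full S l') {y y' : PG F} {s τ s' τ' : Fin 3 → F}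
    (D : LD S w t₁ t₂ l y s τ) (D' : LD S w t₁ t₂ l' y' s' τ')
    (hdir : (s ⬝ᵥ t₁) * (s' ⬝ᵥ t₂) = (s' ⬝ᵥ t₁) * (s ⬝ᵥ t₂)) : l = l' := by
  have aux : ∀ (l y : PG F) (s τ : Fin 3 → F), LD S w t₁ t₂ l y s τ →
      s ⬝ᵥ t₁ ≠ 0 ∧ s ⬝ᵥ t₂ ≠ 0 ∧ (y.rep ⬝ᵥ t₁) * (s ⬝ᵥ t₂) = (y.rep ⬝ᵥ t₂) * (s ⬝ᵥ t₁) := by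
    intro l y s τ D
    obtain ⟨sx, -⟩ := hF.side1.dot_ne hS2 D.m D.yw D.A D.sw D.τw
    obtain ⟨sy, -⟩ := hF.side2.dot_ne hS2 D.m D.yw D.A D.sw D.τw
    refine ⟨sx, sy, ?_⟩
    obtain ⟨-, E⟩ := hF.eqs hS2 D.m D.yw D.A D.sw D.τw
    have Q := D.quad
    have hn : 2 * (s ⬝ᵥ t₁) + s ⬝ᵥ t₂ ≠ 0 := by
      intro h
      have : 3 * (s ⬝ᵥ t₁) ^ 2 = 0 := by
        linear_combination Q - (s ⬝ᵥ t₂ - s ⬝ᵥ t₁) * h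
      exact mul_ne_zero h3 (pow_ne_zero 2 sx) this
    have yw := D.yw
    simp only [g] at E
    apply mul_left_cancel₀ hn
    field_simp at E
    linear_combination (s ⬝ᵥ t₂) * E - 2 * (y.rep ⬝ᵥ t₂) * Q
  obtain ⟨sx, sy, E⟩ := aux l y s τ D
  obtain ⟨sx', sy', E'⟩ := aux l' y' s' τ' D'
  set ψ := (s ⬝ᵥ t₂) • t₁ - (s ⬝ᵥ t₁) • t₂ with hψ
  have dψ : ∀ v : Fin 3 → F, v ⬝ᵥ ψ = (s ⬝ᵥ t₂) * (v ⬝ᵥ t₁) - (s ⬝ᵥ t₁) * (v ⬝ᵥ t₂) := by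
    intro v
    rw [hψ, dotProduct_sub, dotProduct_smul _ v t₁, dotProduct_smul _ v t₂, smul_eq_mul,
      smul_eq_mul]
  have hψ0 : ψ ≠ 0 := by
    intro h
    have h1 := dψ e₁.rep
    rw [h, hF.z1] at h1
    simp only [dotProduct_zero, mul_zero, zero_sub] at h1
    exact mul_ne_zero sx hF.n21 (neg_eq_zero.1 h1.symm)
  have yψ : y.rep ⬝ᵥ ψ = 0 := by rw [dψ]; linear_combination E
  have yψ' : y'.rep ⬝ᵥ ψ = 0 := by
    rw [dψ]
    apply mul_left_cancel₀ sy'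
    linear_combination (s ⬝ᵥ t₂) * E' - (y'.rep ⬝ᵥ t₂) * hdir
  have n3 : N S ψ = 3 := (D.A ψ hψ0 yψ).1 (by rw [dψ]; ring)
  have a1 := hl.2 y D.m D.i (mk F ψ hψ0) ((incid_mk _ _ _).2 yψ) (by rw [N_mk, n3])
  have a2 := hl'.2 y' D'.m D'.i (mk F ψ hψ0) ((incid_mk _ _ _).2 yψ') (by rw [N_mk, n3])
  rw [← a1, ← a2]

lemma Frame.mem_iff {S : Finset (PG F)}
    {w t₁ t₂ : Fin 3 → F} {e₁ e₂ e₃ : PG F} (hF : Frame S w t₁ t₂ e₁ e₂ e₃) (y z : PG F)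
    (hyw : y.rep ⬝ᵥ w ≠ 0) (hzw : z.rep ⬝ᵥ w ≠ 0) (p : PG F) :
    (p ∈ S ∧ ¬ (p = y ∨ p = e₁) ∧ ¬ (p = y ∨ p = z)) ↔
      p ∈ insert e₂ (insert e₃ (((S.filter (fun p => p.rep ⬝ᵥ w ≠ 0)).erase y).erase z)) := by
  simp only [Finset.mem_insert, Finset.mem_erase, Finset.mem_filter]
  have d12 := hF.d12
  have d13 := hF.d13
  constructor
  · rintro ⟨hp, h1, h2⟩
    rw [not_or] at h1 h2
    by_cases hw : p.rep ⬝ᵥ w = 0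
    · rcases (hF.on p hp).1 hw with h | h | h
      · exact absurd h h1.2
      · exact Or.inl h
      · exact Or.inr (Or.inl h)
    · exact Or.inr (Or.inr ⟨h2.2, h2.1, hp, hw⟩)
  · rintro (rfl | rfl | ⟨hpz, hpy, hp, hw⟩)
    · refine ⟨hF.m2, not_or.2 ⟨(hF.side1.ne' hyw).symm, d12.symm⟩,
        not_or.2 ⟨(hF.side1.ne' hyw).symm, (hF.side1.ne' hzw).symm⟩⟩
    · refine ⟨hF.m3, not_or.2 ⟨(hF.side1.ne'' hyw).symm, d13.symm⟩,
        not_or.2 ⟨(hF.side1.ne'' hyw).symm, (hF.side1.ne'' hzw).symm⟩⟩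
    · exact ⟨hp, not_or.2 ⟨hpy, hF.side1.ne hw⟩, not_or.2 ⟨hpy, hpz⟩⟩

set_option maxHeartbeats 1000000 in
/-- two full lines in characteristic 3 -/
lemma char_three (h2 : (2 : F) ≠ 0) (h3 : (3 : F) = 0) (S : Finset (PG F)) (hS2 : S.card ≠ 2)
    {w t₁ t₂ : Fin 3 → F} {e₁ e₂ e₃ : PG F} (hF : Frame S w t₁ t₂ e₁ e₂ e₃)
    (l l' : PG F) (hl : Full S l) (hl' : Full S l') {y z : PG F} {s τ s' τ' : Fin 3 → F}
    (D : LD S w t₁ t₂ l y s τ) (D' : LD S w t₁ t₂ l' z s' τ') : l = l' := by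
  by_contra hll
  have aux : ∀ (l y : PG F) (s τ : Fin 3 → F), LD S w t₁ t₂ l y s τ →
      s ⬝ᵥ t₁ ≠ 0 ∧ τ ⬝ᵥ t₁ ≠ 0 ∧ s ⬝ᵥ t₁ = s ⬝ᵥ t₂ ∧
        g t₂ w y * (τ ⬝ᵥ t₁) = g t₁ w y * (τ ⬝ᵥ t₂) := by
    intro l y s τ D
    obtain ⟨sx, tx⟩ := hF.side1.dot_ne hS2 D.m D.yw D.A D.sw D.τw
    obtain ⟨E, -⟩ := hF.eqs hS2 D.m D.yw D.A D.sw D.τw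
    have Q := D.quad
    have hs : s ⬝ᵥ t₁ = s ⬝ᵥ t₂ := by
      have : (s ⬝ᵥ t₁ - s ⬝ᵥ t₂) ^ 2 = 0 := by
        linear_combination Q - (s ⬝ᵥ t₁) * (s ⬝ᵥ t₂) * h3
      exact sub_eq_zero.1 (pow_eq_zero_iff two_ne_zero |>.1 this)
    refine ⟨sx, tx, hs, ?_⟩
    apply mul_left_cancel₀ sx
    rw [← hs] at E
    linear_combination E
  obtain ⟨sx, tx, hs, hτ⟩ := aux l y s τ D
  obtain ⟨sx', tx', hs', hτ'⟩ := aux l' z s' τ' D'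
  have hzl : ¬ Incid z l := fun h => hll (hl'.2 z D'.m D'.i l (by exact h) hl.1.ge |>.symm ▸ rfl)
  have hyz : y ≠ z := by rintro rfl; exact hzl D.i
  have hy := D.m
  have hz := D'.m
  have hyw := D.yw
  have hzw := D'.yw
  set a := g t₁ w y with ha
  set b := g t₂ w y with hb
  set a' := g t₁ w z with ha'
  set b' := g t₂ w z with hb'
  have ha0 : a ≠ 0 := hF.b1.ne_zero hy hyw
  have ha0' : a' ≠ 0 := hF.b1.ne_zero hz hzw
  have hα : a' - a ≠ 0 := fun h => hyz (hF.b1.inj hy hyw hz hzw (sub_eq_zero.1 h).symm)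
  set L := (b' - b) • U t₁ w y - (a' - a) • U t₂ w y with hL
  have dL : ∀ v, v ⬝ᵥ L = (b' - b) * (v ⬝ᵥ t₁ - a * (v ⬝ᵥ w))
      - (a' - a) * (v ⬝ᵥ t₂ - b * (v ⬝ᵥ w)) := by
    intro v
    rw [hL, dotProduct_sub, dotProduct_smul, dotProduct_smul, U_dot, U_dot, smul_eq_mul,
      smul_eq_mul]
  have gy1 : y.rep ⬝ᵥ t₁ = a * (y.rep ⬝ᵥ w) := by rw [ha, g]; field_simp
  have gy2 : y.rep ⬝ᵥ t₂ = b * (y.rep ⬝ᵥ w) := by rw [hb, g]; field_simp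
  have gz1 : z.rep ⬝ᵥ t₁ = a' * (z.rep ⬝ᵥ w) := by rw [ha', g]; field_simp
  have gz2 : z.rep ⬝ᵥ t₂ = b' * (z.rep ⬝ᵥ w) := by rw [hb', g]; field_simp
  have yL : y.rep ⬝ᵥ L = 0 := by rw [dL, gy1, gy2]; ring
  have zL : z.rep ⬝ᵥ L = 0 := by rw [dL, gz1, gz2]; ring
  have w1 : e₁.rep ⬝ᵥ w = 0 := (hF.on _ hF.m1).2 (Or.inl rfl)
  have w2 : e₂.rep ⬝ᵥ w = 0 := (hF.on _ hF.m2).2 (Or.inr (Or.inl rfl))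
  have w3 : e₃.rep ⬝ᵥ w = 0 := (hF.on _ hF.m3).2 (Or.inr (Or.inr rfl))
  have e1L : e₁.rep ⬝ᵥ L ≠ 0 := by
    rw [dL, w1, hF.z1]
    simpa using ⟨hα, hF.n21⟩
  have hL0 : L ≠ 0 := by
    intro h; apply e1L; rw [h]; simp
  have hsL : s ⬝ᵥ L ≠ 0 := by
    intro h
    have n3 := (D.A L hL0 yL).1 h
    have := hl.2 y hy D.i (mk F L hL0) ((incid_mk _ _ _).2 yL) (by rw [N_mk, n3])
    apply hzl
    rw [← this]
    exact (incid_mk _ _ _).2 zL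
  have hτL : τ ⬝ᵥ L ≠ 0 := by
    intro h
    have n1 := (D.A L hL0 yL).2.1 h
    exact hyz (eq_of_N_one n1 hz hy zL yL)
  have NL : N S L = 2 := (D.A L hL0 yL).2.2 hsL hτL
  obtain ⟨hsL', hτL'⟩ := D'.A.ne hL0 zL NL
  have Lz := eq_of_N_two NL hy hz hyz yL zL
  have Uy := hF.side1.zero_iff hy hyw
  have Uz := hF.side1.zero_iff hz hzw
  have ye := hF.side1.ne hyw
  have ze := hF.side1.ne hzw
  have k1 := prod_PA S hS2 y hy s τ D.A (U t₁ w y) L ((Uy y hy).2 (Or.inl rfl)) yL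
    (hF.side1.N_U hy hyw) NL (by
      intro p hp h1 h2
      rw [Uy p hp] at h1
      rw [Lz p hp] at h2
      rcases h1 with h1 | h1
      · exact h1
      · rcases h2 with h2 | h2
        · exact h2
        · exact absurd (h2.symm.trans h1) ze)
  have k2 := prod_PA S hS2 z hz s' τ' D'.A (U t₁ w z) L ((Uz z hz).2 (Or.inl rfl)) zL
    (hF.side1.N_U hz hzw) NL (by
      intro p hp h1 h2
      rw [Uz p hp] at h1
      rw [Lz p hp] at h2
      rcases h1 with h1 | h1
      · exact h1
      · rcases h2 with h2 | h2
        · exact absurd (h2.symm.trans h1) ye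
        · exact h2)
  set S₁ := ((S.filter (fun p => p.rep ⬝ᵥ w ≠ 0)).erase y).erase z with hS₁
  have d23 := hF.d23
  have set0 := hF.mem_iff y z hyw hzw
  rw [← hS₁] at set0
  have set1 : S.filter (fun p => p.rep ⬝ᵥ U t₁ w y ≠ 0 ∧ p.rep ⬝ᵥ L ≠ 0) =
      insert e₂ (insert e₃ S₁) := by
    ext p
    rw [← set0, Finset.mem_filter]
    refine and_congr_right fun hp => ?_
    rw [ne_eq, ne_eq, Uy p hp, Lz p hp]
  have set2 : S.filter (fun p => p.rep ⬝ᵥ U t₁ w z ≠ 0 ∧ p.rep ⬝ᵥ L ≠ 0) =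
      insert e₂ (insert e₃ S₁) := by
    ext p
    rw [← set0, Finset.mem_filter]
    refine and_congr_right fun hp => ?_
    rw [ne_eq, ne_eq, Uz p hp, Lz p hp]
    constructor
    · rintro ⟨h1, h2⟩
      rw [not_or] at h1 h2
      exact ⟨not_or.2 ⟨h2.1, h1.2⟩, not_or.2 h2⟩
    · rintro ⟨h1, h2⟩
      rw [not_or] at h1 h2
      exact ⟨not_or.2 ⟨h2.2, h1.2⟩, not_or.2 h2⟩
  rw [set1] at k1
  rw [set2] at k2
  have m3 : e₃ ∉ S₁ := by
    simp [hS₁, w3]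
  have m2 : e₂ ∉ insert e₃ S₁ := by
    simp [hS₁, w2, d23]
  have memS₁ : ∀ p ∈ S₁, p.rep ⬝ᵥ w ≠ 0 := by
    intro p hp
    simp only [hS₁, Finset.mem_erase, Finset.mem_filter] at hp
    exact hp.2.2.2
  rw [Finset.prod_insert m2, Finset.prod_insert m3] at k1 k2
  rw [Finset.prod_congr (rfl : S₁ = S₁) (g := fun p => (g t₁ w p - a) *
    ((p.rep ⬝ᵥ w) / (p.rep ⬝ᵥ L)))
    (fun p hp => by rw [U_dot_rep _ _ _ _ (memS₁ p hp)]; ring), Finset.prod_mul_distrib] at k1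
  rw [Finset.prod_congr (rfl : S₁ = S₁) (g := fun p => (g t₁ w p - a') *
    ((p.rep ⬝ᵥ w) / (p.rep ⬝ᵥ L)))
    (fun p hp => by rw [U_dot_rep _ _ _ _ (memS₁ p hp)]; ring), Finset.prod_mul_distrib] at k2
  have q1 := hF.b1.prod hy hyw
  have q2 := hF.b1.prod hz hzw
  have mz : z ∈ (S.filter (fun p => p.rep ⬝ᵥ w ≠ 0)).erase y := by
    simp [hz, hzw, hyz.symm]
  have my : y ∈ (S.filter (fun p => p.rep ⬝ᵥ w ≠ 0)).erase z := by
    simp [hy, hyw, hyz]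
  rw [← Finset.mul_prod_erase _ _ mz] at q1
  rw [← Finset.mul_prod_erase _ _ my, Finset.erase_right_comm] at q2
  simp only [U_dot, w2, w3, D.sw, D.τw, D'.sw, D'.τw, mul_zero, sub_zero] at k1 k2
  simp only [dL, w2, w3, D.sw, D.τw, D'.sw, D'.τw, mul_zero, sub_zero, ← hs, ← hs'] at k1 k2
  have hsL1 : (b' - b) - (a' - a) ≠ 0 := by
    intro h
    apply hsL
    rw [dL, D.sw, ← hs]
    linear_combination (s ⬝ᵥ t₁) * h
  have hD : a * b' - b * a' ≠ 0 := by
    intro h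
    apply hτL
    apply mul_left_cancel₀ ha0
    rw [dL, D.τw]
    linear_combination (τ ⬝ᵥ t₁) * h + (a' - a) * hτ
  have hτL1 : (b' - b) * (τ ⬝ᵥ t₁) - (a' - a) * (τ ⬝ᵥ t₂) ≠ 0 := by
    rw [dL, D.τw] at hτL
    simpa using hτL
  have hτL1' : (b' - b) * (τ' ⬝ᵥ t₁) - (a' - a) * (τ' ⬝ᵥ t₂) ≠ 0 := by
    rw [dL, D'.τw] at hτL'
    simpa using hτL'
  have t1 : (τ ⬝ᵥ t₁) / ((b' - b) * (τ ⬝ᵥ t₁) - (a' - a) * (τ ⬝ᵥ t₂)) = a / (a * b' - b * a') := by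
    rw [div_eq_div_iff hτL1 hD]
    linear_combination -(a' - a) * hτ
  have t2 : (τ' ⬝ᵥ t₁) / ((b' - b) * (τ' ⬝ᵥ t₁) - (a' - a) * (τ' ⬝ᵥ t₂)) =
      a' / (a * b' - b * a') := by
    rw [div_eq_div_iff hτL1' hD]
    linear_combination -(a' - a) * hτ'
  have t3 : (s ⬝ᵥ t₁) / ((b' - b) * (s ⬝ᵥ t₁) - (a' - a) * (s ⬝ᵥ t₁)) =
      1 / ((b' - b) - (a' - a)) := by
    rw [← sub_mul]; field_simp
  have t4 : (s' ⬝ᵥ t₁) / ((b' - b) * (s' ⬝ᵥ t₁) - (a' - a) * (s' ⬝ᵥ t₁)) =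
      1 / ((b' - b) - (a' - a)) := by
    rw [← sub_mul]; field_simp
  rw [t1, t3] at k1
  rw [t2, t4] at k2
  rw [← hS₁] at q1 q2
  rw [← ha, ← ha'] at q1 q2
  generalize ∏ p ∈ S₁, (g t₁ w p - a) = X at *
  generalize ∏ p ∈ S₁, (g t₁ w p - a') = X' at *
  generalize hR2 : (e₂.rep ⬝ᵥ t₁) / _ = R2 at k1 k2
  generalize hR3 : (e₃.rep ⬝ᵥ t₁) / _ = R3 at k1 k2
  generalize hY : (∏ p ∈ S₁, (p.rep ⬝ᵥ w) / _ : F) = Y at k1 k2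
  have hc : R2 * R3 * Y ≠ 0 := by
    intro h
    have : -(1 / ((b' - b) - (a' - a))) = 0 := by
      rw [← k1]
      linear_combination (X * (a / (a * b' - b * a'))) * h
    exact one_div_ne_zero hsL1 (neg_eq_zero.1 this)
  have hXX : X * a = X' * a' := by
    apply mul_left_cancel₀ hc
    have h5 := k1.trans k2.symm
    field_simp at h5
    linear_combination h5
  apply h2
  linear_combination -q1 - q2 + (a' - a) * hXX

lemma root_unique {a b c d : F} (h1 : a ^ 2 + a * b + b ^ 2 = 0)
    (h2 : c ^ 2 + c * d + d ^ 2 = 0) : a * d = c * b ∨ a * d = -(b * d) - c * b := by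
  have : (a * d - c * b) * (a * d + b * d + c * b) = 0 := by
    linear_combination d ^ 2 * h1 - b ^ 2 * h2
  rcases mul_eq_zero.1 this with h | h
  · exact Or.inl (sub_eq_zero.1 h)
  · right; linear_combination h

/-- There are at most three full lines. -/
lemma card_full_le (h2 : (2 : F) ≠ 0) (h7 : 3 ≤ Fintype.card F) (S : Finset (PG F))
    (hS : S.card = Fintype.card F + 2) : (Finset.univ.filter (fun l => Full S l)).card ≤ 3 := by
  by_contra! h
  have hS2 : S.card ≠ 2 := by omega
  obtain ⟨l₀, hl₀⟩ : (Finset.univ.filter (fun l => Full S l)).Nonempty := by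
    rw [← Finset.card_pos]; omega
  have hl₀' := (Finset.mem_filter.1 hl₀).2
  have h4 : 2 < ((Finset.univ.filter (fun l => Full S l)).erase l₀).card := by
    rw [Finset.card_erase_of_mem hl₀]; omega
  obtain ⟨l, m, n, hl, hm, hn, hlm, hln, hmn⟩ := Finset.two_lt_card_iff.1 h4
  simp only [Finset.mem_erase, Finset.mem_filter, Finset.mem_univ, true_and] at hl hm hn
  obtain ⟨t₁, t₂, e₁, e₂, e₃, hF⟩ := exists_frame S hS h7 l₀ hl₀'
  obtain ⟨y₁, s₁, τ₁, D₁⟩ := exists_LD h2 S hS l₀ hl₀' hF l hl.2 hl.1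
  obtain ⟨y₂, s₂, τ₂, D₂⟩ := exists_LD h2 S hS l₀ hl₀' hF m hm.2 hm.1
  obtain ⟨y₃, s₃, τ₃, D₃⟩ := exists_LD h2 S hS l₀ hl₀' hF n hn.2 hn.1
  by_cases h3 : (3 : F) = 0
  · exact hlm (char_three h2 h3 S hS2 hF l m hl.2 hm.2 D₁ D₂)
  · obtain ⟨n1, -⟩ := hF.side2.dot_ne hS2 D₁.m D₁.yw D₁.A D₁.sw D₁.τw
    obtain ⟨n2, -⟩ := hF.side2.dot_ne hS2 D₂.m D₂.yw D₂.A D₂.sw D₂.τw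
    obtain ⟨n3, -⟩ := hF.side2.dot_ne hS2 D₃.m D₃.yw D₃.A D₃.sw D₃.τw
    rcases root_unique D₁.quad D₂.quad with h5 | h5
    · exact hlm (same_dir h3 S hS2 hF l m hl.2 hm.2 D₁ D₂ h5)
    rcases root_unique D₁.quad D₃.quad with h6 | h6
    · exact hln (same_dir h3 S hS2 hF l n hl.2 hn.2 D₁ D₃ h6)
    refine hmn (same_dir h3 S hS2 hF m n hm.2 hn.2 D₂ D₃ ?_)
    apply mul_left_cancel₀ n1
    linear_combination (s₃ ⬝ᵥ t₂) * h5 - (s₂ ⬝ᵥ t₂) * h6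

end fulllines

section counting

open scoped Classical

variable {F : Type*} [Field F] [Fintype F]

/-- lines with at least three points -/
noncomputable def Lg (S : Finset (PG F)) : Finset (PG F) :=
  Finset.univ.filter (fun l => 3 ≤ N S l.rep)

/-- number of long lines through a point -/
noncomputable def dg (S : Finset (PG F)) (x : PG F) : ℕ :=
  ((Lg S).filter (fun l => Incid x l)).card

/-- the share of points owned by a line -/
noncomputable def own (S : Finset (PG F)) (l : PG F) : ℚ :=
  ∑ x ∈ S.filter (fun p => p.rep ⬝ᵥ l.rep = 0), 1 / (dg S x : ℚ)

lemma sum_own (S : Finset (PG F)) (h : ∀ x ∈ S, 1 ≤ dg S x) :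
    ∑ l ∈ Lg S, own S l = S.card := by
  unfold own
  simp_rw [Finset.sum_filter]
  rw [Finset.sum_comm, Finset.card_eq_sum_ones, Nat.cast_sum]
  refine Finset.sum_congr rfl fun x hx => ?_
  rw [← Finset.sum_filter, Finset.sum_const, nsmul_eq_mul]
  have h1 : (dg S x : ℚ) ≠ 0 := by
    have := h x hx
    positivity
  have h2 : ((Lg S).filter (fun l => x.rep ⬝ᵥ l.rep = 0)).card = dg S x := rfl
  rw [h2]
  field_simp
  simp

lemma own_le (S : Finset (PG F)) (l : PG F) : own S l ≤ N S l.rep := by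
  unfold own N
  rw [Finset.card_eq_sum_ones, Nat.cast_sum]
  refine Finset.sum_le_sum fun x _ => ?_
  rcases Nat.eq_zero_or_pos (dg S x) with h | h
  · simp [h]
  · rw [Nat.cast_one, div_le_one (by exact_mod_cast h)]
    exact_mod_cast h

lemma own_le' (S : Finset (PG F)) (l : PG F) (x : PG F) (hx : x ∈ S) (hxl : Incid x l)
    (h2 : 2 ≤ dg S x) : own S l ≤ N S l.rep - 1 / 2 := by
  unfold own N
  have hm : x ∈ S.filter (fun p => p.rep ⬝ᵥ l.rep = 0) := Finset.mem_filter.2 ⟨hx, hxl⟩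
  rw [Finset.card_eq_sum_ones, Nat.cast_sum, ← Finset.add_sum_erase _ _ hm,
    ← Finset.add_sum_erase _ (fun _ => ((1 : ℕ) : ℚ)) hm]
  have h3 : 1 / (dg S x : ℚ) ≤ 1 / 2 := by
    have : (2 : ℚ) ≤ dg S x := by exact_mod_cast h2
    exact one_div_le_one_div_of_le (by norm_num) this
  have h4 : ∑ x ∈ (S.filter (fun p => p.rep ⬝ᵥ l.rep = 0)).erase x, 1 / (dg S x : ℚ) ≤
      ∑ x ∈ (S.filter (fun p => p.rep ⬝ᵥ l.rep = 0)).erase x, ((1 : ℕ) : ℚ) := by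
    refine Finset.sum_le_sum fun x _ => ?_
    rcases Nat.eq_zero_or_pos (dg S x) with h | h
    · simp [h]
    · rw [Nat.cast_one, div_le_one (by exact_mod_cast h)]
      exact_mod_cast h
  push_cast at h4 ⊢
  linarith

lemma own_bound (S : Finset (PG F)) (l : PG F) (hl : l ∈ Lg S) :
    8 * own S l ≤ 5 * (C (N S l.rep) : ℚ) + 4 * (if Full S l then 1 else 0) := by
  have h3 := (Finset.mem_filter.1 hl).2
  have h1 := own_le S l
  rcases Nat.lt_or_ge (N S l.rep) 4 with h4 | h4
  · have h5 : N S l.rep = 3 := by omega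
    by_cases hf : Full S l
    · rw [if_pos hf, h5, C_three]
      rw [h5] at h1
      push_cast at h1 ⊢
      linarith
    · rw [if_neg hf, h5, C_three]
      have : ∃ x ∈ S, Incid x l ∧ ∃ l', Incid x l' ∧ 3 ≤ N S l'.rep ∧ l' ≠ l := by
        by_contra! hcon
        exact hf ⟨h5, hcon⟩
      obtain ⟨x, hx, hxl, l', hxl', hl', hne⟩ := this
      have hd : 2 ≤ dg S x := by
        have : 1 < dg S x := by
          unfold dg
          rw [Finset.one_lt_card]
          refine ⟨l', ?_, l, ?_, hne⟩
          · exact Finset.mem_filter.2 ⟨Finset.mem_filter.2 ⟨Finset.mem_univ _, hl'⟩, hxl'⟩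
          · exact Finset.mem_filter.2 ⟨hl, hxl⟩
        exact this
      have := own_le' S l x hx hxl hd
      rw [h5] at this
      push_cast at this ⊢
      linarith
  · have h6 := C_ge _ h4
    have h7 : (2 * (N S l.rep : ℚ)) ≤ (C (N S l.rep) : ℚ) := by exact_mod_cast h6
    have h8 : (0 : ℚ) ≤ N S l.rep := by positivity
    split_ifs <;> linarith

lemma bound_no_nucleus (h2 : (2 : F) ≠ 0) (h7 : 3 ≤ Fintype.card F) (S : Finset (PG F))
    (hS : S.card = Fintype.card F + 2) (hK : K S = ∅) :
    8 * (Fintype.card F + 2) ≤ 5 * (T S).card + 12 := by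
  have hd : ∀ x ∈ S, 1 ≤ dg S x := by
    intro x hx
    obtain ⟨l, h3, hxl⟩ := exists_long_of_not_nucleus S hS x hx (by rw [hK]; simp)
    exact Finset.card_pos.2 ⟨l, Finset.mem_filter.2
      ⟨Finset.mem_filter.2 ⟨Finset.mem_univ _, h3⟩, hxl⟩⟩
  have h1 := sum_own S hd
  have h3 := Finset.sum_le_sum (fun l hl => own_bound S l hl)
  rw [← Finset.mul_sum, h1, Finset.sum_add_distrib, ← Finset.mul_sum, ← Finset.mul_sum] at h3
  have h4 : (∑ l ∈ Lg S, (if Full S l then 1 else 0 : ℚ)) ≤ 3 := by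
    have h5 := card_full_le h2 h7 S hS
    have h6 : ((Lg S).filter (fun l => Full S l)).card ≤ 3 :=
      (Finset.card_le_card (Finset.filter_subset_filter _ (Finset.subset_univ _))).trans h5
    rw [Finset.card_filter] at h6
    have h8 : ((∑ l ∈ Lg S, (if Full S l then 1 else 0) : ℕ) : ℚ) ≤ 3 := by exact_mod_cast h6
    push_cast at h8
    exact h8
  have h5 : (∑ l ∈ Lg S, (C (N S l.rep) : ℚ)) ≤ (T S).card := by
    have h6 := card_T S hS
    have h8 : ∑ l ∈ Lg S, C (N S l.rep) ≤ ∑ l : PG F, C (N S l.rep) :=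
      Finset.sum_le_sum_of_subset_of_nonneg (Finset.subset_univ _) (fun _ _ _ => C_nonneg _)
    rw [← h6] at h8
    exact_mod_cast h8
  rw [hS] at h3
  have h9 : (8 * ((Fintype.card F + 2 : ℕ) : ℚ)) ≤ 5 * (T S).card + 12 := by linarith
  exact_mod_cast h9

end counting

section jamison

open scoped Classical

variable {F : Type*} [Field F] [Fintype F]

/-- The polynomial `∏ (a l + b l X + c l Y)`. -/
noncomputable def jpoly (A : Finset (PG F)) (n b₁ b₂ : Fin 3 → F) : MvPolynomial (Fin 2) F :=
  ∏ l ∈ A, (MvPolynomial.C (n ⬝ᵥ l.rep) + MvPolynomial.C (b₁ ⬝ᵥ l.rep) * MvPolynomial.X 0 +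
    MvPolynomial.C (b₂ ⬝ᵥ l.rep) * MvPolynomial.X 1)

lemma jpoly_eval (A : Finset (PG F)) (n b₁ b₂ : Fin 3 → F) (x : Fin 2 → F) :
    MvPolynomial.eval x (jpoly A n b₁ b₂) = ∏ l ∈ A, ((n + x 0 • b₁ + x 1 • b₂) ⬝ᵥ l.rep) := by
  rw [jpoly, map_prod]
  refine Finset.prod_congr rfl fun l _ => ?_
  simp only [map_add, map_mul, MvPolynomial.eval_C, MvPolynomial.eval_X, add_dotProduct,
    smul_dotProduct, smul_eq_mul]
  ring

lemma jpoly_deg (A : Finset (PG F)) (n b₁ b₂ : Fin 3 → F) :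
    (jpoly A n b₁ b₂).totalDegree ≤ A.card := by
  refine (MvPolynomial.totalDegree_finsetProd _ _).trans ?_
  rw [Finset.card_eq_sum_ones]
  refine Finset.sum_le_sum fun l _ => ?_
  have hm : ∀ (c : F) (i : Fin 2),
      (MvPolynomial.C c * MvPolynomial.X i : MvPolynomial (Fin 2) F).totalDegree ≤ 1 := by
    intro c i
    refine (MvPolynomial.totalDegree_mul _ _).trans ?_
    rw [MvPolynomial.totalDegree_C, MvPolynomial.totalDegree_X]
  refine (MvPolynomial.totalDegree_add _ _).trans (max_le ?_ (hm _ _))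
  refine (MvPolynomial.totalDegree_add _ _).trans (max_le ?_ (hm _ _))
  rw [MvPolynomial.totalDegree_C]
  exact Nat.zero_le _

lemma jamison (A : Finset (PG F)) (n b₁ b₂ : Fin 3 → F)
    (h0 : ∀ l ∈ A, n ⬝ᵥ l.rep ≠ 0)
    (h1 : ∀ u v : F, (u ≠ 0 ∨ v ≠ 0) → ∃ l ∈ A, (n + u • b₁ + v • b₂) ⬝ᵥ l.rep = 0) :
    2 * (Fintype.card F - 1) ≤ A.card := by
  by_contra! h
  have hs := MvPolynomial.sum_eval_eq_zero (jpoly A n b₁ b₂) (by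
    rw [Fintype.card_fin]
    have := jpoly_deg A n b₁ b₂
    omega)
  rw [Finset.sum_eq_single 0] at hs
  · rw [jpoly_eval, Finset.prod_eq_zero_iff] at hs
    obtain ⟨l, hl, h2⟩ := hs
    apply h0 l hl
    simpa using h2
  · intro x _ hx
    rw [jpoly_eval]
    obtain ⟨l, hl, h2⟩ := h1 (x 0) (x 1) (by
      by_contra! h3
      apply hx
      ext i
      fin_cases i
      · exact h3.1
      · exact h3.2)
    exact Finset.prod_eq_zero hl h2
  · simp

lemma exists_basis3 (x y : PG F) (hxy : x ≠ y) : ∃ b : Fin 3 → F,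
    ∀ u v w : F, u • x.rep + v • y.rep + w • b = 0 → u = 0 ∧ v = 0 ∧ w = 0 := by
  obtain ⟨l, hx, hy⟩ := exists_line x y hxy
  obtain ⟨i, hi⟩ := Function.ne_iff.1 l.rep_nonzero
  refine ⟨Pi.single i 1, ?_⟩
  intro u v w h
  have hw : w = 0 := by
    have h1 := congrArg (fun z => z ⬝ᵥ l.rep) h
    simp only [add_dotProduct, smul_dotProduct, zero_dotProduct, (incid_iff _ _).1 hx,
      (incid_iff _ _).1 hy, single_dotProduct, smul_eq_mul, mul_zero, zero_add, one_mul] at h1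
    exact (mul_eq_zero.1 h1).resolve_right hi
  rw [hw, zero_smul, add_zero] at h
  have hv : v = 0 := by
    by_contra hv
    apply hxy.symm
    rw [← mk_rep x, ← mk_rep y, mk_eq_mk_iff']
    refine ⟨-(v⁻¹ * u), ?_⟩
    have h2 : y.rep = v⁻¹ • (v • y.rep) := by rw [smul_smul, inv_mul_cancel₀ hv, one_smul]
    rw [h2, eq_neg_of_add_eq_zero_right h, smul_neg, smul_smul, neg_smul]
  rw [hv, zero_smul, add_zero] at h
  exact ⟨(smul_eq_zero.1 h).resolve_right x.rep_nonzero, hv, hw⟩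

lemma bound_nucleus (h2 : (2 : F) ≠ 0) (hq : Odd (Fintype.card F)) (S : Finset (PG F))
    (hS : S.card = Fintype.card F + 2) (hK : K S ≠ ∅) :
    2 * (Fintype.card F - 1) ≤ (T S).card := by
  obtain ⟨x, hx⟩ := Finset.nonempty_iff_ne_empty.2 hK
  obtain ⟨hxS, hx2⟩ := Finset.mem_filter.1 hx
  have hc := card_K_le h2 S
  obtain ⟨y, hyx, hy⟩ : ∃ y, y ≠ x ∧ ∀ z ∈ K S, z = x ∨ z = y := by
    by_cases h : ∃ y ∈ K S, y ≠ x
    · obtain ⟨y, hy, hyx⟩ := h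
      refine ⟨y, hyx, fun z hz => ?_⟩
      by_contra! hcon
      have : 2 < (K S).card := Finset.two_lt_card_iff.2
        ⟨x, y, z, hx, hy, hz, hyx.symm, hcon.1.symm, hcon.2.symm⟩
      omega
    · push Not at h
      obtain ⟨y, -, hyx⟩ := Finset.exists_mem_ne (s := S) (by omega) x
      exact ⟨y, hyx, fun z hz => Or.inl (h z hz)⟩
  obtain ⟨b, hb⟩ := exists_basis3 x y hyx.symm
  refine jamison (T S) x.rep y.rep b ?_ ?_
  · intro l hl hxl
    have := (Finset.mem_filter.1 hl).2
    rw [hx2 l hxl] at this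
    exact absurd this (by decide)
  · intro u v huv
    set z := x.rep + u • y.rep + v • b with hz
    have hz0 : z ≠ 0 := by
      intro h
      have := hb 1 u v (by rw [one_smul, ← hz, h])
      exact one_ne_zero this.1
    have nx : mk F z hz0 ≠ x := by
      intro h
      rw [← mk_rep x, mk_eq_mk_iff'] at h
      obtain ⟨c, hc⟩ := h
      have := hb (1 - c) u v (by
        rw [sub_smul, one_smul, hc, hz]; abel)
      rcases huv with h | h
      · exact h this.2.1
      · exact h this.2.2
    have ny : mk F z hz0 ≠ y := by
      intro h
      rw [← mk_rep y, mk_eq_mk_iff'] at h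
      obtain ⟨c, hc⟩ := h
      have := hb 1 (u - c) v (by
        rw [sub_smul, one_smul, hc, hz]; abel)
      exact one_ne_zero this.1
    have : ∃ l ∈ T S, Incid (mk F z hz0) l := by
      by_cases hm : mk F z hz0 ∈ S
      · refine exists_odd_of_not_nucleus S hS _ hm fun hk => ?_
        rcases hy _ hk with h | h
        · exact nx h
        · exact ny h
      · exact exists_odd_of_not_mem hq S hS _ hm
    obtain ⟨l, hl, hi⟩ := this
    refine ⟨l, hl, ?_⟩
    rw [incid_comm, incid_mk, dotProduct_comm] at hi
    exact hi

lemma lower (h2 : (2 : F) ≠ 0) (hq : Odd (Fintype.card F)) (h7 : 7 ≤ Fintype.card F)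
    (S : Finset (PG F)) (hS : S.card = Fintype.card F + 2) :
    3 * (Fintype.card F + 1) ≤ 2 * (T S).card ∧
      (Fintype.card F ≤ 13 → 2 * Fintype.card F - 2 ≤ (T S).card) := by
  have h4 := four_dvd_T S hS
  by_cases hK : K S = ∅
  · have := bound_no_nucleus h2 (by omega) S hS hK
    obtain ⟨k, hk⟩ := hq
    constructor <;> omega
  · have := bound_nucleus h2 hq S hS hK
    constructor <;> omega

end jamison

section upper

open scoped Classical

variable {F : Type*} [Field F] [Fintype F]

/-- The points of a conic together with an external point. -/
def vec : Option (Option F) → Fin 3 → F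
  | none => ![0, 0, 1]
  | some none => ![0, 1, 0]
  | some (some t) => ![1, t, t ^ 2]

lemma vec_ne : ∀ i : Option (Option F), vec i ≠ 0
  | none => fun h => by simpa [vec] using congrFun h 2
  | some none => fun h => by simpa [vec] using congrFun h 1
  | some (some t) => fun h => by simpa [vec] using congrFun h 0

/-- the corresponding projective points -/
noncomputable def pt (i : Option (Option F)) : PG F := mk F (vec i) (vec_ne i)

lemma pt_inj : Function.Injective (pt : Option (Option F) → PG F) := by
  intro i j h
  rw [pt, pt, mk_eq_mk_iff'] at h
  obtain ⟨c, hc⟩ := h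
  have h0 := congrFun hc 0
  have h1 := congrFun hc 1
  have h2 := congrFun hc 2
  rcases i with _ | _ | t <;> rcases j with _ | _ | t' <;> simp [vec] at h0 h1 h2 ⊢
  · simp_all
  · simp_all
  · rw [h0, one_mul] at h1
    exact h1.symm

/-- the set of `q + 2` points -/
noncomputable def SS (F : Type*) [Field F] [Fintype F] : Finset (PG F) :=
  Finset.univ.image (pt : Option (Option F) → PG F)

lemma card_SS : (SS F).card = Fintype.card F + 2 := by
  rw [SS, Finset.card_image_of_injective _ pt_inj, Finset.card_univ]
  simp

lemma pt_dot (i : Option (Option F)) (φ : Fin 3 → F) :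
    (pt i).rep ⬝ᵥ φ = 0 ↔ vec i ⬝ᵥ φ = 0 := by
  rw [dotProduct_comm, pt, rep_mk_dot, dotProduct_comm]

lemma N_SS (φ : Fin 3 → F) : N (SS F) φ =
    (if φ 2 = 0 then 1 else 0) + (if φ 1 = 0 then 1 else 0) +
      (Finset.univ.filter (fun t : F => φ 0 + t * φ 1 + t ^ 2 * φ 2 = 0)).card := by
  rw [N, SS, Finset.card_filter, Finset.sum_image (fun a _ b _ h => pt_inj h)]
  simp_rw [pt_dot]
  rw [Fintype.sum_option, Fintype.sum_option, Finset.card_filter, add_assoc]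
  simp [vec, dotProduct, Fin.sum_univ_three]

/-- possible odd lines, first type -/
noncomputable def o1 (t : F) : PG F :=
  mk F ![t ^ 2, -2 * t, 1] (fun h => by simpa using congrFun h 2)

/-- possible odd lines, second type -/
noncomputable def o2 (t : F) : PG F :=
  mk F ![t, 0, 1] (fun h => by simpa using congrFun h 2)

lemma T_SS (l : PG F) (hl : l ∈ T (SS F)) :
    l ∈ (Finset.univ.erase (0 : F)).image o1 ∪ (Finset.univ.erase (0 : F)).image o2 := by
  have h := (Finset.mem_filter.1 hl).2
  rw [N_SS] at h
  have hne := l.rep_nonzero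
  obtain ⟨φ, hφ⟩ : ∃ φ, φ = l.rep := ⟨_, rfl⟩
  rw [← hφ] at h hne
  have hmk : mk F φ hne = l := by
    conv_rhs => rw [← mk_rep l]
    congr 1
  by_cases hc : φ 2 = 0
  · exfalso
    rw [if_pos hc] at h
    by_cases hb : φ 1 = 0
    · have ha : φ 0 ≠ 0 := by
        intro ha
        apply hne
        ext i
        fin_cases i <;> simp [ha, hb, hc]
      rw [if_pos hb, Finset.filter_false_of_mem (by intro t _; simp [hb, hc, ha]),
        Finset.card_empty] at h
      exact absurd h (by decide)
    · have : (Finset.univ.filter (fun t : F => φ 0 + t * φ 1 + t ^ 2 * φ 2 = 0)) =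
          {-(φ 0) / φ 1} := by
        ext t
        simp only [Finset.mem_filter, Finset.mem_univ, true_and, Finset.mem_singleton, hc,
          mul_zero, add_zero]
        rw [eq_div_iff hb]
        constructor <;> intro h <;> linear_combination h
      rw [if_neg hb, this, Finset.card_singleton] at h
      exact absurd h (by decide)
  · rw [if_neg hc] at h
    by_cases hb : φ 1 = 0
    · have ha : φ 0 ≠ 0 := by
        intro ha
        rw [if_pos hb] at h
        have : (Finset.univ.filter (fun t : F => φ 0 + t * φ 1 + t ^ 2 * φ 2 = 0)) = {0} := by
          ext t
          simp [ha, hb, hc]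
        rw [this, Finset.card_singleton] at h
        exact absurd h (by decide)
      refine Finset.mem_union_right _ (Finset.mem_image.2 ⟨φ 0 / φ 2, ?_, ?_⟩)
      · simp [ha, hc]
      · rw [← hmk, o2, mk_eq_mk_iff']
        refine ⟨(φ 2)⁻¹, ?_⟩
        ext i
        fin_cases i
        · simp [div_eq_inv_mul]
        · simp [hb]
        · simp [hc]
    · rw [if_neg hb, zero_add, zero_add] at h
      obtain ⟨t, ht⟩ := Finset.card_pos.1 h.pos
      have ht := (Finset.mem_filter.1 ht).2
      by_cases htt : -(φ 1) / φ 2 - t = t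
      · have hb' : φ 1 = φ 2 * (-2 * t) := by
          field_simp at htt
          linear_combination -htt
        have ha' : φ 0 = φ 2 * t ^ 2 := by
          rw [hb'] at ht
          linear_combination ht
        refine Finset.mem_union_left _ (Finset.mem_image.2 ⟨t, ?_, ?_⟩)
        · simp only [Finset.mem_erase, Finset.mem_univ, and_true]
          rintro rfl
          apply hb
          rw [hb']; ring
        · rw [← hmk, o1, mk_eq_mk_iff']
          refine ⟨(φ 2)⁻¹, ?_⟩
          ext i
          fin_cases i
          · simp [ha', hc]
          · simp [hb', hc]
          · simp [hc]
      · exfalso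
        have : (Finset.univ.filter (fun t : F => φ 0 + t * φ 1 + t ^ 2 * φ 2 = 0)) =
            {-(φ 1) / φ 2 - t, t} := by
          ext r
          simp only [Finset.mem_filter, Finset.mem_univ, true_and, Finset.mem_insert,
            Finset.mem_singleton]
          have key : φ 0 + r * φ 1 + r ^ 2 * φ 2 =
              φ 2 * (r - (-(φ 1) / φ 2 - t)) * (r - t) := by
            field_simp
            linear_combination ht
          rw [key]
          simp [hc, sub_eq_zero]
        rw [this, Finset.card_pair htt] at h
        exact absurd h (by decide)

lemma upper : (T (SS F)).card ≤ 2 * Fintype.card F - 2 := by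
  refine (Finset.card_le_card (fun l hl => T_SS l hl)).trans ?_
  refine (Finset.card_union_le _ _).trans ?_
  have h1 := Finset.card_image_le (s := Finset.univ.erase (0 : F)) (f := o1)
  have h2 := Finset.card_image_le (s := Finset.univ.erase (0 : F)) (f := o2)
  rw [Finset.card_erase_of_mem (Finset.mem_univ _), Finset.card_univ] at h1 h2
  omega

lemma Podd_card (R : Set (PG F)) : (Podd F R).ncard = (T R.toFinset).card := by
  rw [← Set.ncard_coe_finset]
  congr 1
  ext l
  have hT : l ∈ ((T R.toFinset : Finset (PG F)) : Set (PG F)) ↔ Odd (N R.toFinset l.rep) := by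
    rw [Finset.mem_coe, T, Finset.mem_filter]
    simp
  rw [hT]
  simp only [Podd, N, Set.mem_ofPred_eq]
  have : {p ∈ R | Incid l p} = ((R.toFinset.filter (fun p => p.rep ⬝ᵥ l.rep = 0) :
      Finset (PG F)) : Set (PG F)) := by
    ext p
    simp only [Set.mem_ofPred_eq, Finset.coe_filter, Set.mem_toFinset]
    rw [incid_comm, incid_iff]
  rw [this, Set.ncard_coe_finset]

end upper

open scoped Classical in
lemma final {F : Type*} [Field F] [Fintype F] (q : ℕ)
    (hcard : Fintype.card F = q) (hq : Odd q) (h7 : 7 ≤ q) :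
    (3 * (q + 1) ≤ 2 * fmin F (q + 2) ∧ fmin F (q + 2) ≤ 2 * q - 2) ∧
    (q ≤ 13 → fmin F (q + 2) = 2 * q - 2) := by
  subst hcard
  have h2 : (2 : F) ≠ 0 := by
    intro h
    have h3 := FiniteField.cast_card_eq_zero F
    obtain ⟨k, hk⟩ := hq
    rw [hk] at h3
    push_cast at h3
    rw [h, zero_mul, zero_add] at h3
    exact one_ne_zero h3
  have hmem : ((SS F : Set (PG F))).ncard = Fintype.card F + 2 := by
    rw [Set.ncard_coe_finset, card_SS]
  have hle : fmin F (Fintype.card F + 2) ≤ 2 * Fintype.card F - 2 := by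
    refine le_trans (Nat.sInf_le ⟨(SS F : Set (PG F)), hmem, rfl⟩) ?_
    rw [Podd_card]
    simpa using upper (F := F)
  obtain ⟨R, hR, hn⟩ := Nat.sInf_mem (s := {n | ∃ R : Set (PG F),
    R.ncard = Fintype.card F + 2 ∧ (Podd F R).ncard = n}) ⟨_, (SS F : Set (PG F)), hmem, rfl⟩
  change _ = fmin F (Fintype.card F + 2) at hn
  rw [← hn] at hle ⊢
  rw [Podd_card] at hle ⊢
  rw [Set.ncard_eq_toFinset_card'] at hR
  obtain ⟨l1, l2⟩ := lower h2 hq h7 R.toFinset hR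
  exact ⟨⟨l1, hle⟩, fun h => le_antisymm hle (l2 h)⟩

end Aux6

/-- For `q ≥ 7`, `(3/2)(q+1) ≤ f(q+2) ≤ 2q − 2`; moreover `f(q+2) = 2q − 2`
when additionally `q ≤ 13`.  (The first inequality is stated multiplied by `2`
to stay in the integers.) -/
theorem stmt6 {F : Type*} [Field F] [Fintype F] (q : ℕ)
    (hcard : Fintype.card F = q) (hq : Odd q) (h7 : 7 ≤ q) :
    (3 * (q + 1) ≤ 2 * fmin F (q + 2) ∧ fmin F (q + 2) ≤ 2 * q - 2) ∧
    (q ≤ 13 → fmin F (q + 2) = 2 * q - 2) := by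
  exact Aux6.final q hcard hq h7
end
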